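/- arXiv:1608.03906 — 15 statements merged into one kernel-verified Lean document; each statement's English description precedes it below -/
import Mathlib

section
/- Let f : S → ℂ be a non-zero solution of the equation ∫_S f(σ(y)xt) dμ(t) − ∫_S f(xyt) dμ(t) = 2 f(x) f(y) for all x, y ∈ S. Then f(σ(x)) = −f(x) for all x ∈ S. -/
theorem stmt0 {S : Type*} [Semigroup S] (σ : S → S)
    (hmor : (∀ x y : S, σ (x * y) = σ x * σ y) ∨ (∀ x y : S, σ (x * y) = σ y * σ x))
    (hinv : ∀ x : S, σ (σ x) = x)
    {I : Type*} [Fintype I] (c : I → ℂ) (z : I → S)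
    (hcen : ∀ i : I, ∀ s : S, z i * s = s * z i)
    (f : S → ℂ) (hf : f ≠ 0)
    (heq : ∀ x y : S, (∑ i, c i * f (σ y * x * z i)) - (∑ i, c i * f (x * y * z i))
      = 2 * f x * f y) :
    ∀ x : S, f (σ x) = - f x := by
  intro x
  have h1 := heq x x
  have h2 := heq (σ x) x
  have h3 := heq (σ x) (σ x)
  have h4 := heq x (σ x)
  simp only [hinv] at h3 h4
  have h : (f (σ x) + f x) ^ 2 = 0 := by
    linear_combination -(h1 + h2 + h3 + h4) / 2
  exact eq_neg_of_add_eq_zero_left (pow_eq_zero_iff two_ne_zero |>.mp h)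
end

section
/- Let f : S → ℂ be a non-zero solution of the equation ∫_S f(σ(y)xt) dμ(t) − ∫_S f(xyt) dμ(t) = 2 f(x) f(y) for all x, y ∈ S. Then ∫_S f(t) dμ(t) ≠ 0. -/
theorem stmt1 {S : Type*} [Semigroup S] (σ : S → S)
    (hmor : (∀ x y : S, σ (x * y) = σ x * σ y) ∨ (∀ x y : S, σ (x * y) = σ y * σ x))
    (hinv : ∀ x : S, σ (σ x) = x)
    {I : Type*} [Fintype I] (c : I → ℂ) (z : I → S)
    (hcen : ∀ i : I, ∀ s : S, z i * s = s * z i)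
    (f : S → ℂ) (hf : f ≠ 0)
    (heq : ∀ x y : S, (∑ i, c i * f (σ y * x * z i)) - (∑ i, c i * f (x * y * z i))
      = 2 * f x * f y) :
    (∑ i, c i * f (z i)) ≠ 0 := by
  intro hM
  obtain ⟨F, hF⟩ : ∃ F : S → ℂ, ∀ x, F x = ∑ i, c i * f (x * z i) := ⟨_, fun _ => rfl⟩
  obtain ⟨G, hG⟩ : ∃ G : S → ℂ, ∀ x, G x = ∑ i, c i * F (x * z i) := ⟨_, fun _ => rfl⟩
  have H : ∀ x y, F (σ y * x) - F (x * y) = 2 * f x * f y := fun x y => by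
    rw [hF, hF]; exact heq x y
  obtain ⟨a, ha⟩ : ∃ a, f a ≠ 0 := Function.ne_iff.mp hf
  have hodd : ∀ x, f (σ x) = -f x := by
    have key : ∀ x y, (f x + f (σ x)) * (f y + f (σ y)) = 0 := fun x y => by
      have h1 := H x y
      have h2 := H y (σ x)
      have h3 := H (σ x) (σ y)
      have h4 := H (σ y) x
      simp only [hinv] at h2 h3 h4
      linear_combination (-h1 - h2 - h3 - h4) / 2
    intro x
    have := mul_self_eq_zero.mp (key x x)
    linear_combination this
  -- averaging the equation over `x * z j`
  have hx : ∀ x y, G (σ y * x) - G (x * y) = 2 * F x * f y := fun x y => by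
    rw [hG, hG, hF x, Finset.mul_sum, Finset.sum_mul, ← Finset.sum_sub_distrib]
    refine Finset.sum_congr rfl fun j _ => ?_
    have h := H (x * z j) y
    rw [mul_assoc x (z j) y, hcen, ← mul_assoc, ← mul_assoc] at h
    linear_combination c j * h
  -- averaging the equation over `x = z j`
  have heven : ∀ y, G (σ y) = G y := fun y => by
    have h : G (σ y) - G y = 2 * (∑ j, c j * f (z j)) * f y := by
      rw [hG, hG, Finset.mul_sum, Finset.sum_mul, ← Finset.sum_sub_distrib]
      refine Finset.sum_congr rfl fun j _ => ?_
      have h := H (z j) y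
      rw [hcen j y] at h
      linear_combination c j * h
    rw [hM] at h
    linear_combination h
  -- averaging the equation over `y = z j`
  have hσ : ∀ x, ∑ j, c j * F (σ (z j) * x) = G x := fun x => by
    have h : ∑ j, c j * F (σ (z j) * x) - G x = 2 * f x * ∑ j, c j * f (z j) := by
      rw [hG, Finset.mul_sum, ← Finset.sum_sub_distrib]
      refine Finset.sum_congr rfl fun j _ => ?_
      linear_combination c j * H x (z j)
    rw [hM] at h
    linear_combination h
  -- averaging the equation over `y * z j`
  have hy : ∀ x y, G (σ y * x) - G (x * y) = 2 * f x * F y := fun x y => by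
    rw [← hσ (σ y * x), hG, hF y, Finset.mul_sum, ← Finset.sum_sub_distrib]
    refine Finset.sum_congr rfl fun j _ => ?_
    have hs : σ (y * z j) = σ (z j) * σ y := by
      rcases hmor with h | h
      · rw [← hcen, h]
      · rw [h]
    have h := H x (y * z j)
    rw [hs, mul_assoc, ← mul_assoc x y] at h
    linear_combination c j * h
  obtain ⟨l, hl⟩ : ∃ l, ∀ x, F x = l * f x := by
    refine ⟨F a / f a, fun x => ?_⟩
    field_simp
    linear_combination (hy a x - hx a x) / -2
  have hGl : ∀ x, G x = l * (l * f x) := fun x => by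
    rw [← hl, hF, hG, Finset.mul_sum]
    refine Finset.sum_congr rfl fun j _ => ?_
    rw [hl]; ring
  have hl0 : l = 0 := by
    have h := heven a
    rw [hGl, hGl, hodd] at h
    have h2 : l * l * f a = 0 := by linear_combination -h / 2
    simpa [ha] using h2
  have h := H a a
  rw [hl, hl, hl0] at h
  have h2 : f a * f a = 0 := by linear_combination -h / 2
  exact ha (mul_self_eq_zero.mp h2)
end

section
/- Let f : S → ℂ be a non-zero solution of the equation ∫_S f(σ(y)xt) dμ(t) − ∫_S f(xyt) dμ(t) = 2 f(x) f(y) for all x, y ∈ S. Then f(σ(y)x) = −f(σ(x)y) for all x, y ∈ S. -/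
/-- If `f` satisfies the Van Vleck equation `F (σ y * x) - F (x * y) = 2 * f x * f y` for some `F`,
then `f` is odd under the involution. -/
theorem odd_of_vanVleck {S : Type*} [Semigroup S] {σ : S → S} (hinv : ∀ x, σ (σ x) = x)
    {f F : S → ℂ} (hE : ∀ x y, F (σ y * x) - F (x * y) = 2 * f x * f y) (x : S) :
    f (σ x) = -f x := by
  have h1 := hE x (σ x)
  have h2 := hE (σ x) x
  have h3 := hE x x
  have h4 := hE (σ x) (σ x)
  rw [hinv] at h1 h4
  have h : (f x + f (σ x)) * (f x + f (σ x)) = 0 := by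
    linear_combination (-1 / 2) * (h1 + h2 + h3 + h4)
  linear_combination mul_self_eq_zero.mp h

/-- A map `d` with `g z * d x y = -(g x * d z y)` vanishes when `g` is non-zero. -/
theorem eq_zero_of_mul_antisymm {S : Type*} {g : S → ℂ} {d : S → S → ℂ}
    (h : ∀ x y z, g z * d x y = -(g x * d z y)) {p : S} (hp : g p ≠ 0) (x y : S) :
    d x y = 0 := by
  have h1 : g p * d p y = 0 := by linear_combination (1 / 2) * h p y p
  have h2 : d p y = 0 := (mul_eq_zero.mp h1).resolve_left hp
  have h3 := h x y p
  rw [h2, mul_zero, neg_zero] at h3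
  exact (mul_eq_zero.mp h3).resolve_left hp

/-- For an automorphism `σ`, a non-zero solution `f` is central; here `F` and `K` are the first and
second integrals of `f` against a central measure. -/
theorem central_of_vanVleck {S : Type*} [Semigroup S] {σ : S → S}
    (hσ : ∀ x y, σ (x * y) = σ x * σ y) (hinv : ∀ x, σ (σ x) = x)
    {f F K : S → ℂ} (hf : f ≠ 0)
    (hE : ∀ x y, F (σ y * x) - F (x * y) = 2 * f x * f y)
    (hK₁ : ∀ x y, K (σ y * x) - K (x * y) = 2 * F x * f y)
    (hK₂ : ∀ x y, K (y * σ x) - K (x * y) = 2 * f x * F y) (x y : S) :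
    f (x * y) = f (y * x) := by
  have hodd := odd_of_vanVleck hinv hE
  obtain ⟨p, hp⟩ := Function.ne_iff.mp hf
  rw [Pi.zero_apply] at hp
  have hFσ : ∀ x y, F (σ x * y) = F (x * σ y) := fun x y => by
    have h1 := hE y x
    have h2 := hE x (σ y)
    rw [hinv, hodd] at h2
    linear_combination h1 + h2
  have hD : ∀ x y, K (y * σ x) - K (σ x * y) = K (x * y) - K (y * x) := fun x y => by
    linear_combination hK₂ x y - hK₁ y x
  have hDσ : ∀ x y, K (σ x * σ y) - K (σ y * σ x) = K (x * y) - K (y * x) := fun x y => by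
    rw [← hD x y, ← hD y (σ x)]
  have hN : ∀ x y, K (x * y) - K (σ x * σ y) = -2 * f x * F (σ y) - 2 * F x * f y :=
    fun x y => by
      have h := hK₂ (σ x) (σ y)
      rw [hinv, hodd] at h
      linear_combination h - hK₁ x y
  have hsymm : ∀ x y, f x * (F y - F (σ y)) = f y * (F x - F (σ x)) := fun x y => by
    linear_combination (-1 / 2) * (hN x y - hN y x + hDσ x y)
  have hFprod : ∀ x y, F (x * y) = F (σ (x * y)) := fun x y => by
    rw [hσ, hFσ, hinv]
  by_cases hα : F p = F (σ p)
  swap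
  · have hvan : ∀ x y, f (x * y) = 0 := fun x y => by
      have h := hsymm p (x * y)
      rw [← hFprod, sub_self, mul_zero] at h
      exact (mul_eq_zero.mp h.symm).resolve_right (sub_ne_zero.mpr hα)
    rw [hvan, hvan]
  have heven : ∀ x, F (σ x) = F x := fun x => by
    have h := hsymm p x
    rw [← hα, sub_self, mul_zero] at h
    linear_combination -(mul_eq_zero.mp h).resolve_left hp
  obtain ⟨q, hq⟩ : ∃ q, F q ≠ 0 := by
    by_contra! h
    have h1 := hE p p
    rw [h, h] at h1
    exact mul_ne_zero (mul_ne_zero two_ne_zero hp) hp (by linear_combination -h1)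
  have hP : ∀ x y z, f (x * y) * F z + F (x * y) * f z = f x * F (y * z) + F x * f (y * z) :=
    fun x y z => by
      have h1 := hN (x * y) z
      have h2 := hN x (y * z)
      rw [heven] at h1 h2
      simp only [hσ, mul_assoc] at h1 h2
      linear_combination (1 / 2) * (h1 - h2)
  have hQ : ∀ x y z, f z * (F (x * y) - F (y * x)) + F z * (f (x * y) - f (y * x))
      = -(f x * (F (z * y) - F (y * z)) + F x * (f (z * y) - f (y * z))) := fun x y z => by
    linear_combination hP x y z - hP y x z - hP x z y
  have hdFσ : ∀ x y, F (σ x * y) - F (y * σ x) = -(F (x * y) - F (y * x)) := fun x y => by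
    linear_combination hE y x - hE x y + hFσ y x
  have hdF : ∀ x y, F (x * y) - F (y * x) = 0 := fun x y => by
    refine eq_zero_of_mul_antisymm (g := f) (d := fun x y => F (x * y) - F (y * x))
      (fun x y z => ?_) hp x y
    have h1 := hQ x y z
    have h2 := hQ x y (σ z)
    have h3 := hQ (σ x) y z
    have h4 := hQ (σ x) y (σ z)
    simp only [hodd, heven, hdFσ] at h1 h2 h3 h4
    linear_combination (1 / 4) * (h1 - h2 - h3 + h4)
  refine sub_eq_zero.mp (eq_zero_of_mul_antisymm (g := F)
    (d := fun x y => f (x * y) - f (y * x)) (fun x y z => ?_) hq x y)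
  have h := hQ x y z
  rw [hdF, hdF] at h
  linear_combination h

theorem stmt2 {S : Type*} [Semigroup S] (σ : S → S)
    (hmor : (∀ x y : S, σ (x * y) = σ x * σ y) ∨ (∀ x y : S, σ (x * y) = σ y * σ x))
    (hinv : ∀ x : S, σ (σ x) = x)
    {I : Type*} [Fintype I] (c : I → ℂ) (z : I → S)
    (hcen : ∀ i : I, ∀ s : S, z i * s = s * z i)
    (f : S → ℂ) (hf : f ≠ 0)
    (heq : ∀ x y : S, (∑ i, c i * f (σ y * x * z i)) - (∑ i, c i * f (x * y * z i))
      = 2 * f x * f y) :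
    ∀ x y : S, f (σ y * x) = - f (σ x * y) := by
  obtain ⟨F, hF⟩ : ∃ F : S → ℂ, ∀ x, F x = ∑ i, c i * f (x * z i) := ⟨_, fun _ => rfl⟩
  have hE : ∀ x y, F (σ y * x) - F (x * y) = 2 * f x * f y := fun x y => by
    rw [hF, hF, heq]
  have hodd := odd_of_vanVleck hinv hE
  intro x y
  rw [← hodd]
  rcases hmor with hσ | hσ
  · have hFσ : ∀ x y, F (σ x * y) = F (x * σ y) := fun x y => by
      have h1 := hE y x
      have h2 := hE x (σ y)
      rw [hinv, hodd] at h2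
      linear_combination h1 + h2
    rw [hσ, hinv]
    refine central_of_vanVleck hσ hinv (K := fun x => ∑ i, c i * F (x * z i)) hf hE
      (fun x y => ?_) (fun x y => ?_) _ _
    · rw [hF x, Finset.mul_sum, Finset.sum_mul, ← Finset.sum_sub_distrib]
      refine Finset.sum_congr rfl fun i _ => ?_
      have h := hE (x * z i) y
      rw [mul_assoc x, hcen, ← mul_assoc, ← mul_assoc] at h
      linear_combination c i * h
    · rw [hF y, Finset.mul_sum, ← Finset.sum_sub_distrib]
      refine Finset.sum_congr rfl fun i _ => ?_
      have h := hE x (y * z i)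
      rw [hFσ, mul_assoc y, hcen, ← mul_assoc, ← mul_assoc] at h
      linear_combination c i * h
  · rw [hσ, hinv]
end

section
/- Let f : S → ℂ be a non-zero solution of the equation ∫_S f(σ(y)xt) dμ(t) − ∫_S f(xyt) dμ(t) = 2 f(x) f(y) for all x, y ∈ S. Then ∫_S ∫_S f(x σ(t) s) dμ(t) dμ(s) = f(x) ∫_S f(t) dμ(t) for all x ∈ S. -/
theorem stmt3 {S : Type*} [Semigroup S] (σ : S → S)
    (hmor : (∀ x y : S, σ (x * y) = σ x * σ y) ∨ (∀ x y : S, σ (x * y) = σ y * σ x))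
    (hinv : ∀ x : S, σ (σ x) = x)
    {I : Type*} [Fintype I] (c : I → ℂ) (z : I → S)
    (hcen : ∀ i : I, ∀ s : S, z i * s = s * z i)
    (f : S → ℂ) (hf : f ≠ 0)
    (heq : ∀ x y : S, (∑ i, c i * f (σ y * x * z i)) - (∑ i, c i * f (x * y * z i))
      = 2 * f x * f y) :
    ∀ x : S, (∑ i, ∑ j, c i * c j * f (x * σ (z i) * z j)) = f x * ∑ i, c i * f (z i) := by
  obtain ⟨F, hF⟩ : ∃ F : S → ℂ, ∀ x, ∑ i, c i * f (x * z i) = F x := ⟨_, fun _ => rfl⟩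
  simp only [hF] at heq
  have hG : ∀ x y, F (σ x * y) - F (x * σ y) = 2 * f x * (f (σ y) + f y) := by
    intro x y
    have h1 := heq x (σ y)
    rw [hinv] at h1
    linear_combination h1 + heq y x
  have hodd : ∀ x, f (σ x) = - f x := by
    intro x
    have h1 := hG x x
    have h2 := hG (σ x) (σ x)
    simp only [hinv] at h2
    have h3 : (f (σ x) + f x) ^ 2 = 0 := by linear_combination -(h1 + h2) / 2
    exact eq_neg_of_add_eq_zero_left (pow_eq_zero_iff two_ne_zero |>.1 h3)
  have hswap : ∀ x y, F (σ x * y) = F (x * σ y) := by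
    intro x y
    have h := hG x y
    rw [hodd y] at h
    linear_combination h
  have hcen' : ∀ i s, σ (z i) * s = s * σ (z i) := by
    intro i s
    have h := congrArg σ (hcen i (σ s))
    rcases hmor with h' | h' <;> simp only [h', hinv] at h
    · exact h
    · exact h.symm
  have hσ : ∀ x i j, σ (x * σ (z i) * z j) = σ x * σ (z j) * z i := by
    intro x i j
    rcases hmor with h' | h' <;> simp only [h', hinv]
    · rw [mul_assoc, hcen, mul_assoc]
    · rw [hcen i, ← mul_assoc, hcen' j]
  have hH : ∀ x, ∑ i, ∑ j, c i * c j * f (x * σ (z i) * z j) = ∑ i, c i * F (x * σ (z i)) := by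
    intro x
    simp only [← hF, Finset.mul_sum, mul_assoc]
  have hHodd : ∀ x, ∑ i, c i * F (σ x * σ (z i)) = - ∑ i, c i * F (x * σ (z i)) := by
    intro x
    rw [← hH, ← hH, Finset.sum_comm, ← Finset.sum_neg_distrib]
    refine Finset.sum_congr rfl fun i _ => ?_
    rw [← Finset.sum_neg_distrib]
    refine Finset.sum_congr rfl fun j _ => ?_
    rw [← hσ, hodd]
    ring
  intro x
  rw [hH]
  have hK : ∑ i, c i * F (x * z i) = - ∑ i, c i * F (x * σ (z i)) := by
    rw [← hHodd]
    refine Finset.sum_congr rfl fun i _ => ?_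
    rw [← hswap, hinv]
  have hdiff : ∑ i, c i * F (x * σ (z i)) - ∑ i, c i * F (x * z i)
      = 2 * (f x * ∑ i, c i * f (z i)) := by
    rw [← Finset.sum_sub_distrib, Finset.mul_sum, Finset.mul_sum]
    refine Finset.sum_congr rfl fun i _ => ?_
    have h := heq x (z i)
    rw [hcen'] at h
    linear_combination c i * h
  linear_combination (hdiff + hK) / 2
end

section
/- Let f : S → ℂ be a non-zero solution of the equation ∫_S f(σ(y)xt) dμ(t) − ∫_S f(xyt) dμ(t) = 2 f(x) f(y) for all x, y ∈ S. Then ∫_S ∫_S f(x t s) dμ(t) dμ(s) = −f(x) ∫_S f(t) dμ(t) for all x ∈ S. -/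
theorem stmt4 {S : Type*} [Semigroup S] (σ : S → S)
    (hmor : (∀ x y : S, σ (x * y) = σ x * σ y) ∨ (∀ x y : S, σ (x * y) = σ y * σ x))
    (hinv : ∀ x : S, σ (σ x) = x)
    {I : Type*} [Fintype I] (c : I → ℂ) (z : I → S)
    (hcen : ∀ i : I, ∀ s : S, z i * s = s * z i)
    (f : S → ℂ) (hf : f ≠ 0)
    (heq : ∀ x y : S, (∑ i, c i * f (σ y * x * z i)) - (∑ i, c i * f (x * y * z i))
      = 2 * f x * f y) :
    ∀ x : S, (∑ i, ∑ j, c i * c j * f (x * z i * z j)) = - (f x * ∑ i, c i * f (z i)) := by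
  obtain ⟨a, ha⟩ : ∃ a, f a ≠ 0 := Function.ne_iff.mp hf
  have hσcen : ∀ i s, σ (z i) * s = s * σ (z i) := by
    intro i s
    have h := congrArg σ (hcen i (σ s))
    rcases hmor with hm | hm <;> simp only [hm, hinv] at h
    · exact h
    · exact h.symm
  have hσmul : ∀ i s, σ (s * z i) = σ (z i) * σ s := by
    intro i s
    rcases hmor with hm | hm
    · rw [hm, hσcen]
    · rw [hm]
  obtain ⟨F, hF⟩ : ∃ F : S → ℂ, ∀ x, F x = ∑ i, c i * f (x * z i) := ⟨_, fun _ => rfl⟩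
  obtain ⟨G, hG⟩ : ∃ G : S → ℂ, ∀ x, G x = ∑ i, c i * F (x * z i) := ⟨_, fun _ => rfl⟩
  obtain ⟨K, hK⟩ : ∃ K : S → ℂ, ∀ x, K x = ∑ i, c i * F (σ (z i) * x) := ⟨_, fun _ => rfl⟩
  obtain ⟨M, hM⟩ : ∃ M : ℂ, M = ∑ i, c i * f (z i) := ⟨_, rfl⟩
  simp only [← hF] at heq
  suffices hmain : ∀ x, G x = -(f x * M) by
    intro x
    rw [← hM, ← hmain, hG]
    refine Finset.sum_congr rfl fun i _ => ?_
    rw [hF, Finset.mul_sum]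
    exact Finset.sum_congr rfl fun j _ => by ring
  have odd_f : ∀ x, f (σ x) = -f x := by
    have key : ∀ x, (f x + f (σ x)) * (f x + f (σ x)) = 0 := by
      intro x
      have h1 := heq x x
      have h2 := heq (σ x) x
      have h3 := heq x (σ x)
      have h4 := heq (σ x) (σ x)
      simp only [hinv] at h1 h2 h3 h4
      linear_combination (-(h1 + h2 + h3 + h4)) / 2
    intro x
    linear_combination mul_self_eq_zero.mp (key x)
  have F_σσ : ∀ x y, F (σ x * σ y) = F (x * y) := by
    intro x y
    have h := heq (σ y) x
    rw [odd_f] at h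
    linear_combination h + heq x y
  have KG : ∀ x, K x - G x = 2 * f x * M := by
    intro x
    rw [hK, hG, hM, ← Finset.sum_sub_distrib, Finset.mul_sum]
    refine Finset.sum_congr rfl fun i _ => ?_
    linear_combination c i * heq x (z i)
  have K_eq : ∀ x y, K (σ y * x) - G (x * y) = 2 * f x * F y := by
    intro x y
    rw [hK, hG, hF y, ← Finset.sum_sub_distrib, Finset.mul_sum]
    refine Finset.sum_congr rfl fun i _ => ?_
    have h := heq x (y * z i)
    rw [hσmul, mul_assoc, ← mul_assoc x] at h
    linear_combination c i * h
  have G_eq : ∀ x y, G (σ y * x) - G (x * y) = 2 * F x * f y := by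
    intro x y
    rw [hG, hG, hF x, ← Finset.sum_sub_distrib, Finset.mul_sum, Finset.sum_mul]
    refine Finset.sum_congr rfl fun i _ => ?_
    have h := heq (x * z i) y
    rw [← mul_assoc, mul_assoc x, hcen, ← mul_assoc x] at h
    linear_combination c i * h
  have sine_sub : ∀ x y, M * f (σ y * x) = f x * F y - F x * f y := by
    intro x y
    linear_combination (K_eq x y - G_eq x y - KG (σ y * x)) / 2
  have F_sub : ∀ x y, M * F (σ y * x) = F x * F y - G x * f y := by
    intro x y
    rw [hF (σ y * x), hF x, hG, Finset.mul_sum, Finset.sum_mul, Finset.sum_mul,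
      ← Finset.sum_sub_distrib]
    refine Finset.sum_congr rfl fun i _ => ?_
    have h := sine_sub (x * z i) y
    rw [← mul_assoc] at h
    linear_combination c i * h
  have F_add : ∀ x y, M * F (y * x) = F x * F (σ y) + G x * f y := by
    intro x y
    have h := F_sub x (σ y)
    rw [hinv, odd_f] at h
    linear_combination h
  have quad : ∀ x y, F x * F y - G x * f y - F y * F (σ x) - G y * f x
      = 2 * M * f x * f y := by
    intro x y
    linear_combination M * heq x y - F_sub x y + F_add y x
  have F_cross : ∀ x y, F x * F (σ y) = F (σ x) * F y := by
    intro x y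
    linear_combination quad x y - quad y x
  obtain ⟨b, hb⟩ : ∃ b, F b ≠ 0 := by
    by_contra! h
    have h1 := heq a a
    rw [h, h] at h1
    simp [ha] at h1
  have F_parity : (∀ x, F (σ x) = F x) ∨ (∀ x, F (σ x) = -F x) := by
    have h := F_cross b (σ b)
    rw [hinv] at h
    rcases mul_self_eq_mul_self_iff.mp h.symm with h | h
    · refine Or.inl fun x => mul_left_cancel₀ hb ?_
      rw [F_cross, h]
    · refine Or.inr fun x => mul_left_cancel₀ hb ?_
      rw [F_cross, h]
      ring
  rcases F_parity with he | ho
  · have hGa : G a = -(f a * M) := by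
      apply mul_left_cancel₀ ha
      have h := quad a a
      rw [he] at h
      linear_combination -h / 2
    intro x
    apply mul_left_cancel₀ ha
    have h := quad x a
    rw [he, hGa] at h
    linear_combination -h
  · rcases hmor with hm | hm
    · have hz : ∀ x y, F (x * y) = 0 := by
        intro x y
        have h := F_σσ x y
        rw [← hm, ho] at h
        linear_combination -h / 2
      have h1 := heq a a
      rw [hz, hz] at h1
      simp [ha] at h1
    · have hanti : ∀ x y, F (x * y) = -F (y * x) := by
        intro x y
        rw [← F_σσ, ← hm, ho]
      have hG0 : ∀ x, G x = 0 := by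
        intro x
        rw [hG]
        refine Finset.sum_eq_zero fun i _ => ?_
        have h := hanti x (z i)
        rw [hcen] at h
        linear_combination c i * h / 2
      have hK0 : ∀ x, K x = 0 := by
        intro x
        rw [hK]
        refine Finset.sum_eq_zero fun i _ => ?_
        have h := hanti (σ (z i)) x
        rw [hσcen] at h ⊢
        linear_combination c i * h / 2
      intro x
      linear_combination (hK0 x - KG x) / 2 + hG0 x / 2
end

section
/- Let f : S → ℂ be a non-zero solution of the equation ∫_S f(σ(y)xt) dμ(t) − ∫_S f(xyt) dμ(t) = 2 f(x) f(y) for all x, y ∈ S. Then ∫_S f(σ(x)t) dμ(t) = ∫_S f(xt) dμ(t) and ∫_S f(x σ(t)) dμ(t) = ∫_S f(σ(x) σ(t)) dμ(t) for all x ∈ S. -/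
theorem stmt5 {S : Type*} [Semigroup S] (σ : S → S)
    (hmor : (∀ x y : S, σ (x * y) = σ x * σ y) ∨ (∀ x y : S, σ (x * y) = σ y * σ x))
    (hinv : ∀ x : S, σ (σ x) = x)
    {I : Type*} [Fintype I] (c : I → ℂ) (z : I → S)
    (hcen : ∀ i : I, ∀ s : S, z i * s = s * z i)
    (f : S → ℂ) (hf : f ≠ 0)
    (heq : ∀ x y : S, (∑ i, c i * f (σ y * x * z i)) - (∑ i, c i * f (x * y * z i))
      = 2 * f x * f y) :
    ∀ x : S, (∑ i, c i * f (σ x * z i)) = (∑ i, c i * f (x * z i)) ∧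
      (∑ i, c i * f (x * σ (z i))) = (∑ i, c i * f (σ x * σ (z i))) := by
  have hσz : ∀ i s, σ (s * z i) = σ s * σ (z i) := by
    intro i s
    rcases hmor with h | h
    · exact h _ _
    · rw [← hcen, h]
  have hσcen : ∀ i s, σ (z i) * s = s * σ (z i) := by
    intro i s
    have h1 := hσz i (σ s)
    rw [← hcen, hinv] at h1
    rcases hmor with h | h
    · rw [← h1, h, hinv]
    · have h2 := h (σ s) (z i)
      rw [← hcen, h1, hinv] at h2
      exact h2.symm
  have hσz' : ∀ i s, σ (s * σ (z i)) = σ s * z i := by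
    intro i s
    rcases hmor with h | h
    · rw [h, hinv]
    · rw [h, hinv, hcen]
  obtain ⟨F, hF⟩ : ∃ F : S → ℂ, ∀ x, F x = ∑ i, c i * f (x * z i) := ⟨_, fun _ => rfl⟩
  obtain ⟨F₂, hF₂⟩ : ∃ F₂ : S → ℂ, ∀ x, F₂ x = ∑ i, c i * F (x * z i) := ⟨_, fun _ => rfl⟩
  simp only [← hF] at heq ⊢
  have hodd : ∀ x, f (σ x) = - f x := by
    intro x
    have h1 := heq x x
    have h2 := heq (σ x) x
    have h3 := heq (σ x) (σ x)
    have h4 := heq x (σ x)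
    simp only [hinv] at h1 h2 h3 h4
    have h5 : (f (σ x) + f x) ^ 2 = 0 := by linear_combination -(h1 + h2 + h3 + h4) / 2
    exact eq_neg_of_add_eq_zero_left (pow_eq_zero_iff two_ne_zero |>.1 h5)
  have hprod : ∀ x y, F (σ x * σ y) = F (x * y) := by
    intro x y
    have h1 := heq x y
    have h2 := heq (σ y) x
    rw [hodd] at h2
    linear_combination h1 + h2
  have hright : ∀ x y, F₂ (y * σ x) - F₂ (x * y) = 2 * f x * F y := by
    intro x y
    rw [hF₂, hF₂, hF, Finset.mul_sum, ← Finset.sum_sub_distrib]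
    refine Finset.sum_congr rfl fun i _ => ?_
    have h1 := heq x (y * z i)
    have h2 := hprod (σ y) (x * σ (z i))
    rw [hσz', hinv, ← mul_assoc] at h2
    rw [hσz, mul_assoc, hσcen, ← h2, ← mul_assoc] at h1
    linear_combination c i * h1
  have hleft : ∀ x y, F₂ (σ y * x) - F₂ (x * y) = 2 * F x * f y := by
    intro x y
    rw [hF₂, hF₂, hF, Finset.mul_sum, Finset.sum_mul, ← Finset.sum_sub_distrib]
    refine Finset.sum_congr rfl fun i _ => ?_
    have h1 := heq (x * z i) y
    rw [mul_assoc x, hcen, ← mul_assoc, ← mul_assoc] at h1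
    linear_combination c i * h1
  have hprop : ∀ x y, f x * (F (σ y) - F y) = f y * (F (σ x) - F x) := by
    intro x y
    have h1 := hright x (σ y)
    have h2 := hright (σ x) y
    have h3 := hleft (σ x) y
    have h4 := hleft x (σ y)
    simp only [hinv, hodd] at h1 h2 h3 h4
    linear_combination (h3 + h4 - h1 - h2) / 2
  have hanti : ∀ x y, (F (σ (x * y)) - F (x * y)) + (F (σ (y * x)) - F (y * x)) = 0 := by
    intro x y
    rcases hmor with h | h
    · rw [h, h, hprod, hprod]; ring
    · rw [h, h, hprod, hprod]; ring
  have heven : ∀ x, F (σ x) = F x := by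
    intro x
    by_contra hx
    have hx' : F (σ x) - F x ≠ 0 := sub_ne_zero.2 hx
    have hfanti : ∀ a b, f (a * b) = - f (b * a) := by
      intro a b
      refine eq_neg_of_add_eq_zero_left (mul_right_cancel₀ hx' ?_)
      rw [zero_mul]
      linear_combination f x * hanti a b - hprop x (a * b) - hprop x (b * a)
    have hF0 : ∀ a, F a = 0 := by
      intro a
      rw [hF]
      refine Finset.sum_eq_zero fun i _ => ?_
      have h := hfanti a (z i)
      rw [hcen, eq_neg_iff_add_eq_zero, ← two_mul] at h
      rw [(mul_eq_zero.1 h).resolve_left two_ne_zero, mul_zero]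
    refine hf (funext fun a => ?_)
    have h := heq a a
    rw [hF0, hF0] at h
    simpa using h.symm
  have hG : ∀ x, ∑ i, c i * f (x * σ (z i)) = - F (σ x) := by
    intro x
    rw [hF, ← Finset.sum_neg_distrib]
    refine Finset.sum_congr rfl fun i _ => ?_
    rw [← hσz', hodd]
    ring
  intro x
  refine ⟨heven x, ?_⟩
  rw [hG, hG, heven (σ x)]
end

section
/- Let f : S → ℂ be a non-zero solution of the equation ∫_S f(σ(y)xt) dμ(t) − ∫_S f(xyt) dμ(t) = 2 f(x) f(y) for all x, y ∈ S. Then ∫_S ∫_S f(ts) dμ(t) dμ(s) = ∫_S ∫_S f(t σ(s)) dμ(t) dμ(s) = 0. -/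
theorem stmt6 {S : Type*} [Semigroup S] (σ : S → S)
    (hmor : (∀ x y : S, σ (x * y) = σ x * σ y) ∨ (∀ x y : S, σ (x * y) = σ y * σ x))
    (hinv : ∀ x : S, σ (σ x) = x)
    {I : Type*} [Fintype I] (c : I → ℂ) (z : I → S)
    (hcen : ∀ i : I, ∀ s : S, z i * s = s * z i)
    (f : S → ℂ) (hf : f ≠ 0)
    (heq : ∀ x y : S, (∑ i, c i * f (σ y * x * z i)) - (∑ i, c i * f (x * y * z i))
      = 2 * f x * f y) :
    (∑ i, ∑ j, c i * c j * f (z i * z j)) = 0 ∧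
      (∑ i, ∑ j, c i * c j * f (z i * σ (z j))) = 0 := by
  have hcen' : ∀ i s, σ (z i) * s = s * σ (z i) := by
    intro i s
    rcases hmor with h | h
    · rw [← hinv s, ← h, hcen, h]
    · rw [← hinv s, ← h, ← hcen, h]
  have hmul : ∀ x i, σ (x * z i) = σ x * σ (z i) := by
    intro x i
    rcases hmor with h | h
    · exact h _ _
    · rw [h, hcen']
  have hmul' : ∀ x i, σ (x * σ (z i)) = σ x * z i := by
    intro x i
    rcases hmor with h | h
    · rw [h, hinv]
    · rw [h, hinv, hcen]
  obtain ⟨F, hF⟩ : ∃ F : S → ℂ, ∀ x, F x = ∑ i, c i * f (x * z i) := ⟨_, fun _ => rfl⟩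
  have hE : ∀ x y, F (σ y * x) - F (x * y) = 2 * f x * f y := by
    intro x y
    rw [hF, hF, heq]
  have hG : ∀ x y, F (σ x * y) - F (x * σ y) = 2 * f x * (f y + f (σ y)) := by
    intro x y
    have h1 := hE x (σ y)
    have h2 := hE y x
    rw [hinv] at h1
    linear_combination h1 + h2
  have hodd : ∀ x, f (σ x) = -f x := by
    intro x
    have h1 := hG x x
    have h2 := hG (σ x) (σ x)
    rw [hinv] at h2
    have h3 : (f x + f (σ x)) ^ 2 = 0 := by linear_combination (-1 / 2) * h1 - (1 / 2) * h2
    linear_combination pow_eq_zero_iff two_ne_zero |>.mp h3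
  have hF_comm : ∀ x y, F (σ x * y) = F (x * σ y) := by
    intro x y
    have h := hG x y
    rw [hodd y] at h
    linear_combination h
  obtain ⟨a, ha⟩ : ∃ a : ℂ, a = ∑ i, c i * f (z i) := ⟨_, rfl⟩
  obtain ⟨M, hM⟩ : ∃ M : S → ℂ, ∀ x, M x = ∑ i, c i * F (x * z i) := ⟨_, fun _ => rfl⟩
  obtain ⟨N, hN⟩ : ∃ N : S → ℂ, ∀ x, N x = ∑ i, c i * F (x * σ (z i)) := ⟨_, fun _ => rfl⟩
  have hNM : ∀ x, N x = M (σ x) := by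
    intro x
    rw [hN, hM]
    refine Finset.sum_congr rfl fun i _ => ?_
    rw [← hcen', hF_comm, hcen]
  have hNodd : ∀ x, N (σ x) = -N x := by
    intro x
    simp only [hN, hF, Finset.mul_sum, ← Finset.sum_neg_distrib]
    rw [Finset.sum_comm]
    refine Finset.sum_congr rfl fun i _ => Finset.sum_congr rfl fun j _ => ?_
    have h : σ x * σ (z j) * z i = σ (x * σ (z i) * z j) := by
      rw [hmul, hmul', mul_assoc, mul_assoc, hcen]
    rw [h, hodd]
    ring
  have hNM_sub : ∀ x, N x - M x = 2 * a * f x := by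
    intro x
    rw [hN, hM, ha, ← Finset.sum_sub_distrib, Finset.mul_sum, Finset.sum_mul]
    refine Finset.sum_congr rfl fun i _ => ?_
    rw [← hcen']
    linear_combination c i * hE x (z i)
  have hMN : ∀ x, M x = -N x := by
    intro x
    rw [← hNodd, hNM, hinv]
  have hMf : ∀ x, M x = -(a * f x) := by
    intro x
    linear_combination (1 / 2) * hMN x - (1 / 2) * hNM_sub x
  have hNf : ∀ x, N x = a * f x := by
    intro x
    linear_combination (1 / 2) * hNM_sub x + (1 / 2) * hMN x
  have hplus : ∀ x y, N (σ y * x) - M (x * y) = 2 * f x * F y := by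
    intro x y
    rw [hN, hM, hF y, ← Finset.sum_sub_distrib, Finset.mul_sum]
    refine Finset.sum_congr rfl fun i _ => ?_
    have h := hE x (y * z i)
    rw [hmul, mul_assoc (σ y), hcen', ← mul_assoc, ← mul_assoc] at h
    linear_combination c i * h
  have hminus : ∀ x y, M (σ y * x) - M (x * y) = 2 * F x * f y := by
    intro x y
    rw [hM, hM, hF x, ← Finset.sum_sub_distrib, Finset.mul_sum, Finset.sum_mul]
    refine Finset.sum_congr rfl fun i _ => ?_
    have h := hE (x * z i) y
    rw [mul_assoc x, hcen, ← mul_assoc, ← mul_assoc] at h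
    linear_combination c i * h
  have hadd : ∀ x y, a * f (x * y) = f x * F y + F x * f y := by
    intro x y
    have h1 := hplus x y
    have h2 := hminus x y
    rw [hNf, hMf] at h1
    rw [hMf, hMf] at h2
    linear_combination (1 / 2) * h1 + (1 / 2) * h2
  obtain ⟨x₀, hx₀⟩ : ∃ x, f x ≠ 0 := by
    by_contra! h
    exact hf (funext h)
  have ha0 : a ≠ 0 := by
    rintro rfl
    have hF0 : ∀ y, F y = 0 := by
      intro y
      have h := hplus x₀ y
      rw [hNf, hMf] at h
      have h' : f x₀ * F y = 0 := by linear_combination (-1 / 2) * h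
      exact (mul_eq_zero.mp h').resolve_left hx₀
    have h := hE x₀ x₀
    rw [hF0, hF0] at h
    exact hx₀ (mul_self_eq_zero.mp (by linear_combination (-1 / 2) * h))
  constructor
  · obtain ⟨A, hA⟩ : ∃ A : ℂ, A = ∑ i, ∑ j, c i * c j * f (z i * z j) := ⟨_, rfl⟩
    have hA' : A = ∑ i, c i * F (z i) := by
      rw [hA]
      refine Finset.sum_congr rfl fun i _ => ?_
      rw [hF, Finset.mul_sum]
      exact Finset.sum_congr rfl fun j _ => by ring
    have h : a * A = a * A + a * A := by
      calc a * A = ∑ i, ∑ j, (c i * f (z i) * (c j * F (z j))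
            + c i * F (z i) * (c j * f (z j))) := by
            rw [hA, Finset.mul_sum]
            refine Finset.sum_congr rfl fun i _ => ?_
            rw [Finset.mul_sum]
            refine Finset.sum_congr rfl fun j _ => ?_
            linear_combination c i * c j * hadd (z i) (z j)
        _ = a * A + a * A := by
            simp only [Finset.sum_add_distrib, ← Finset.mul_sum, ← Finset.sum_mul]
            rw [← hA', ← ha]
            ring
    rw [← hA]
    exact (mul_eq_zero.mp (by linear_combination -h)).resolve_left ha0
  · rw [← self_eq_neg]
    conv_lhs => rw [Finset.sum_comm]
    simp only [← Finset.sum_neg_distrib]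
    refine Finset.sum_congr rfl fun i _ => Finset.sum_congr rfl fun j _ => ?_
    have h : z j * σ (z i) = σ (z i * σ (z j)) := by rw [hmul', hcen']
    rw [h, hodd]
    ring
end

section
/- Let f : S → ℂ be a non-zero solution of the equation ∫_S f(σ(y)xt) dμ(t) − ∫_S f(xyt) dμ(t) = 2 f(x) f(y) for all x, y ∈ S, and define g(x) := (∫_S f(xt) dμ(t)) / (∫_S f(t) dμ(t)) (the denominator being non-zero). Then g is a non-zero solution of the variant d'Alembert equation g(xy) + g(σ(y)x) = 2 g(x) g(y) for all x, y ∈ S, and moreover ∫_S g(s) dμ(s) = 0. -/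
theorem stmt7 {S : Type*} [Semigroup S] (σ : S → S)
    (hmor : (∀ x y : S, σ (x * y) = σ x * σ y) ∨ (∀ x y : S, σ (x * y) = σ y * σ x))
    (hinv : ∀ x : S, σ (σ x) = x)
    {I : Type*} [Fintype I] (c : I → ℂ) (z : I → S)
    (hcen : ∀ i : I, ∀ s : S, z i * s = s * z i)
    (f : S → ℂ) (hf : f ≠ 0)
    (heq : ∀ x y : S, (∑ i, c i * f (σ y * x * z i)) - (∑ i, c i * f (x * y * z i))
      = 2 * f x * f y) 
    (g : S → ℂ)
    (hg : ∀ x : S, g x = (∑ i, c i * f (x * z i)) / (∑ i, c i * f (z i))) :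
    g ≠ 0 ∧ (∀ x y : S, g (x * y) + g (σ y * x) = 2 * g x * g y) ∧
      (∑ i, c i * g (z i)) = 0 := by
  have hzσ (i : I) (s : S) : σ (z i) * s = s * σ (z i) := by
    have h := congrArg σ (hcen i (σ s))
    rcases hmor with hm | hm
    · simpa only [hm, hinv] using h
    · simpa only [hm, hinv] using h.symm
  have hσz (w : S) (i : I) : σ (w * z i) = σ w * σ (z i) := by
    rcases hmor with hm | hm
    · exact hm _ _
    · rw [hm, hzσ]
  have hσσz (w : S) (i : I) : σ (w * σ (z i)) = σ w * z i := by
    rcases hmor with hm | hm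
    · rw [hm, hinv]
    · rw [hm, hinv, hcen]
  obtain ⟨a, ha⟩ : ∃ a, f a ≠ 0 := Function.ne_iff.mp hf
  -- `F` and `G` average `f` over right translation by `z i` and `σ (z i)`.
  set F : S → ℂ := fun x => ∑ i, c i * f (x * z i) with hF
  set G : S → ℂ := fun x => ∑ i, c i * f (x * σ (z i)) with hG
  set m : ℂ := ∑ i, c i * f (z i) with hm
  have hE (x y : S) : F (σ y * x) - F (x * y) = 2 * f x * f y := heq x y
  have hodd (x : S) : f (σ x) = -f x := by
    have key (x y : S) : F (σ x * y) - F (x * σ y) = 2 * f x * (f y + f (σ y)) := by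
      have h2 := hE y x
      have h3 := hE x (σ y)
      rw [hinv] at h3
      linear_combination h2 + h3
    have h1 := key x x
    have h2 := key (σ x) (σ x)
    rw [hinv] at h2
    have h3 : (f x + f (σ x)) ^ 2 = 0 := by linear_combination -(h1 + h2) / 2
    linear_combination pow_eq_zero_iff (two_ne_zero) |>.mp h3
  have hswap (x y : S) : F (σ x * y) = F (x * σ y) := by
    have h2 := hE y x
    have h3 := hE x (σ y)
    rw [hinv, hodd] at h3
    linear_combination h2 + h3
  have hFσ (w : S) : F (σ w) = -G w := by
    simp only [hF, hG, ← hσσz, hodd, mul_neg, Finset.sum_neg_distrib]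
  have hcomm (x : S) : ∑ j, c j * F (x * σ (z j)) = ∑ j, c j * G (x * z j) := by
    simp only [hF, hG, Finset.mul_sum]
    rw [Finset.sum_comm]
    refine Finset.sum_congr rfl fun i _ => Finset.sum_congr rfl fun j _ => ?_
    rw [mul_assoc x, mul_assoc x, hcen]
    ring
  have hdiff (x : S) :
      ∑ j, c j * F (x * σ (z j)) - ∑ j, c j * F (x * z j) = 2 * m * f x := by
    rw [← Finset.sum_sub_distrib, hm, Finset.mul_sum, Finset.sum_mul]
    refine Finset.sum_congr rfl fun j _ => ?_
    have h := hE x (z j)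
    rw [hzσ] at h
    linear_combination c j * h
  have hFG (x : S) : ∑ j, c j * F (x * σ (z j)) = -∑ j, c j * G (x * σ (z j)) := by
    simp only [← hswap, ← Finset.sum_neg_distrib, ← hσσz, hFσ, mul_neg]
  have hFF (x : S) : ∑ j, c j * F (x * z j) = -∑ j, c j * F (x * σ (z j)) := by
    have h1 : ∑ j, c j * F (σ x * σ (z j)) = -∑ j, c j * G (x * z j) := by
      simp only [← hσz, hFσ, mul_neg, Finset.sum_neg_distrib]
    have h2 : ∑ j, c j * F (σ x * σ (z j)) = ∑ j, c j * F (x * z j) := by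
      simp only [← hswap, hinv]
    rw [← h2, h1, hcomm]
  have hA (x : S) : ∑ j, c j * F (x * σ (z j)) = m * f x := by
    linear_combination (hdiff x + hFF x) / 2
  have hB (x : S) : ∑ j, c j * F (x * z j) = -(m * f x) := by
    rw [hFF, hA]
  have hC (x : S) : ∑ j, c j * G (x * σ (z j)) = -(m * f x) := by
    linear_combination hA x * (-1) + hFG x
  have hwil (x y : S) : m * (f (x * y) - f (σ y * x)) = 2 * F x * f y := by
    have h : ∑ i, c i * F (σ y * x * z i) - ∑ i, c i * F (x * y * z i) = 2 * F x * f y := by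
      rw [← Finset.sum_sub_distrib]
      simp only [hF, Finset.mul_sum, Finset.sum_mul]
      refine Finset.sum_congr rfl fun i _ => ?_
      have h := hE (x * z i) y
      have e1 : σ y * x * z i = σ y * (x * z i) := mul_assoc _ _ _
      have e2 : x * y * z i = x * z i * y := by rw [mul_assoc, ← hcen, mul_assoc]
      simp only [← Finset.mul_sum, e1, e2]
      linear_combination c i * h
    rw [hB, hB] at h
    linear_combination h
  have hF0 : ∃ b, F b ≠ 0 := by
    by_contra! h0
    have h := hE a a
    rw [h0, h0] at h
    exact ha (mul_self_eq_zero.mp (by linear_combination -h / 2))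
  obtain ⟨b, hb⟩ := hF0
  have hm0 : m ≠ 0 := by
    intro h0
    have h := hwil b a
    rw [h0] at h
    exact mul_ne_zero hb ha (by linear_combination -h / 2)
  have hGF (w : S) : G w = -F w := by
    have h1 : ∑ k, c k * ∑ j, c j * F (w * σ (z k) * σ (z j)) = m * G w := by
      simp only [hA, hG, Finset.mul_sum]
      exact Finset.sum_congr rfl fun _ _ => by ring
    have h2 : ∑ k, c k * ∑ j, c j * G (w * z k * σ (z j)) = -(m * F w) := by
      simp only [hC, hF, Finset.mul_sum, ← Finset.sum_neg_distrib]
      exact Finset.sum_congr rfl fun _ _ => by ring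
    have h3 : ∑ k, c k * ∑ j, c j * F (w * σ (z k) * σ (z j))
        = ∑ k, c k * ∑ j, c j * G (w * z k * σ (z j)) := by
      simp only [hcomm, Finset.mul_sum]
      rw [Finset.sum_comm]
      refine Finset.sum_congr rfl fun i _ => Finset.sum_congr rfl fun j _ => ?_
      rw [mul_assoc w, mul_assoc w, hcen]
      ring
    apply mul_left_cancel₀ hm0
    linear_combination h2 + h3 - h1
  have hgF (x : S) : g x = F x / m := hg x
  refine ⟨Function.ne_iff.mpr ⟨b, by rw [hgF]; exact div_ne_zero hb hm0⟩, fun x y => ?_, ?_⟩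
  · have h : m * (F (x * y) - G (σ y * x)) = 2 * F x * F y := by
      simp only [hF, hG, ← Finset.sum_sub_distrib]
      rw [Finset.mul_sum, Finset.mul_sum]
      refine Finset.sum_congr rfl fun i _ => ?_
      have h := hwil x (y * z i)
      have e : σ (y * z i) * x = σ y * x * σ (z i) := by rw [hσz, mul_assoc, hzσ, mul_assoc]
      rw [e, ← mul_assoc] at h
      linear_combination c i * h
    rw [hGF] at h
    simp only [hgF]
    field_simp
    linear_combination h
  · have h1 : ∑ j, c j * G (z j) = -∑ j, c j * G (z j) := by
      conv_rhs => simp only [hG, Finset.mul_sum]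
      rw [Finset.sum_comm, ← Finset.sum_neg_distrib]
      simp only [hG, Finset.mul_sum, ← Finset.sum_neg_distrib]
      refine Finset.sum_congr rfl fun i _ => Finset.sum_congr rfl fun j _ => ?_
      have h := hodd (z i * σ (z j))
      rw [hσσz, ← hcen] at h
      linear_combination (c i * c j) * h
    have h2 : ∑ j, c j * F (z j) = -∑ j, c j * G (z j) := by
      simp only [hGF, mul_neg, Finset.sum_neg_distrib, neg_neg]
    have h3 : ∑ j, c j * F (z j) = 0 := by linear_combination h2 - h1 / 2
    simp only [hgF, mul_div_assoc', ← Finset.sum_div, h3, zero_div]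
end

section
/- Let f : S → ℂ be a non-zero solution of the equation ∫_S f(σ(y)xt) dμ(t) − ∫_S f(xyt) dμ(t) = 2 f(x) f(y) for all x, y ∈ S, and define g(x) := (∫_S f(xt) dμ(t)) / (∫_S f(t) dμ(t)). Then there exists a non-zero multiplicative function χ : S → ℂ (χ(xy) = χ(x)χ(y)) such that g = (χ + χ∘σ)/2. -/
theorem stmt8 {S : Type*} [Semigroup S] (σ : S → S)
    (hmor : (∀ x y : S, σ (x * y) = σ x * σ y) ∨ (∀ x y : S, σ (x * y) = σ y * σ x))
    (hinv : ∀ x : S, σ (σ x) = x)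
    {I : Type*} [Fintype I] (c : I → ℂ) (z : I → S)
    (hcen : ∀ i : I, ∀ s : S, z i * s = s * z i)
    (f : S → ℂ) (hf : f ≠ 0)
    (heq : ∀ x y : S, (∑ i, c i * f (σ y * x * z i)) - (∑ i, c i * f (x * y * z i))
      = 2 * f x * f y) 
    (g : S → ℂ)
    (hg : ∀ x : S, g x = (∑ i, c i * f (x * z i)) / (∑ i, c i * f (z i))) :
    ∃ χ : S → ℂ, χ ≠ 0 ∧ (∀ x y : S, χ (x * y) = χ x * χ y) ∧
      ∀ x : S, g x = (χ x + χ (σ x)) / 2 := by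
  have hodd : ∀ x, f (σ x) = -f x := by
    obtain ⟨F, hF⟩ : ∃ F : S → ℂ, ∀ x, F x = ∑ i, c i * f (x * z i) := ⟨_, fun _ => rfl⟩
    simp only [← hF] at heq
    have hsum : ∀ x y, F (σ y * σ x) - F (y * x) = 2 * f y * (f x + f (σ x)) := by
      intro x y
      linear_combination heq (σ x) y + heq y x
    intro x
    have h1 := hsum x x
    have h2 := hsum (σ x) (σ x)
    simp only [hinv] at h2
    have h3 : (f (σ x) + f x) ^ 2 = 0 := by linear_combination -(h1 + h2) / 2
    exact eq_neg_of_add_eq_zero_left (pow_eq_zero_iff two_ne_zero |>.mp h3)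
  have hcen' : ∀ i s, σ (z i) * s = s * σ (z i) := by
    intro i s
    have h := congrArg σ (hcen i (σ s))
    rcases hmor with hm | hm
    · simpa only [hm, hinv] using h
    · simpa only [hm, hinv] using h.symm
  have hσz : ∀ i x, σ (x * z i) = σ x * σ (z i) := by
    intro i x
    rcases hmor with hm | hm
    · exact hm _ _
    · rw [hm, hcen']
  have hσz' : ∀ i x, σ (x * σ (z i)) = σ x * z i := by
    intro i x
    rcases hmor with hm | hm
    · rw [hm, hinv]
    · rw [hm, hinv, hcen]
  obtain ⟨F, hF⟩ : ∃ F : S → ℂ, ∀ x, F x = ∑ i, c i * f (x * z i) := ⟨_, fun _ => rfl⟩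
  obtain ⟨M, hM⟩ : ∃ M : ℂ, M = ∑ i, c i * f (z i) := ⟨_, rfl⟩
  obtain ⟨G, hG⟩ : ∃ G : S → ℂ, ∀ x, G x = ∑ i, c i * F (x * z i) := ⟨_, fun _ => rfl⟩
  obtain ⟨A, hA⟩ : ∃ A : S → ℂ, ∀ x, A x = ∑ i, c i * F (x * σ (z i)) := ⟨_, fun _ => rfl⟩
  simp only [← hF] at heq
  simp only [← hF, ← hM] at hg
  have hFσ : ∀ x y, F (σ y * σ x) = F (y * x) := by
    intro x y
    linear_combination heq (σ x) y + heq y x + 2 * f y * hodd x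
  have hAG : ∀ x, A x - G x = 2 * f x * M := by
    intro x
    rw [hA, hG, hM, ← Finset.sum_sub_distrib, Finset.mul_sum]
    refine Finset.sum_congr rfl fun i _ => ?_
    have h := heq x (z i)
    rw [hcen'] at h
    linear_combination c i * h
  have h_right : ∀ x y, A (σ y * x) - G (x * y) = 2 * f x * F y := by
    intro x y
    rw [hA, hG, hF, ← Finset.sum_sub_distrib, Finset.mul_sum]
    refine Finset.sum_congr rfl fun i _ => ?_
    have h := heq x (y * z i)
    rw [hσz, mul_assoc, hcen', ← mul_assoc, ← mul_assoc] at h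
    linear_combination c i * h
  have h_left : ∀ x y, G (σ y * x) - G (x * y) = 2 * F x * f y := by
    intro x y
    rw [hG, hG, hF, ← Finset.sum_sub_distrib, Finset.mul_sum, Finset.sum_mul]
    refine Finset.sum_congr rfl fun i _ => ?_
    have h := heq (x * z i) y
    rw [mul_assoc x, hcen, ← mul_assoc, ← mul_assoc] at h
    linear_combination c i * h
  have h_rightσ : ∀ x y, G (σ y * x) - A (x * y) = -2 * f x * F (σ y) := by
    intro x y
    rw [hG, hA, hF, ← Finset.sum_sub_distrib, Finset.mul_sum]
    refine Finset.sum_congr rfl fun i _ => ?_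
    have h := heq x (y * σ (z i))
    have h' := hodd (y * σ (z i))
    rw [hσz'] at h'
    rw [hσz', mul_assoc, hcen, ← mul_assoc, ← mul_assoc] at h
    linear_combination c i * h + 2 * c i * f x * h'
  have hsub : ∀ x y, M * f (σ y * x) = f x * F y - F x * f y := by
    intro x y
    linear_combination (h_right x y - h_left x y - hAG (σ y * x)) / 2
  have hadd : ∀ x y, M * f (x * y) = F x * f y + f x * F (σ y) := by
    intro x y
    linear_combination (h_left x y - h_rightσ x y - hAG (x * y)) / 2
  obtain ⟨a, ha⟩ : ∃ a, f a ≠ 0 := Function.ne_iff.mp hf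
  have hM0 : M ≠ 0 := by
    intro h0
    have h1 : ∀ y, f a * F y = F a * f y := by
      intro y
      linear_combination f (σ y * a) * h0 - hsub a y
    have h2 : ∀ y, f a * G y = F a * F y := by
      intro y
      rw [hG, hF y, Finset.mul_sum, Finset.mul_sum]
      refine Finset.sum_congr rfl fun i _ => ?_
      linear_combination c i * h1 (y * z i)
    have h3 : ∀ y, G (σ y) = G y := by
      intro y
      have h : G (σ y) - G y = 2 * M * f y := by
        rw [hG, hG, hM, ← Finset.sum_sub_distrib, Finset.mul_sum, Finset.sum_mul]
        refine Finset.sum_congr rfl fun i _ => ?_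
        have h := heq (z i) y
        rw [hcen] at h
        linear_combination c i * h
      linear_combination h + 2 * f y * h0
    have h4 : F a ^ 2 * f a = 0 := by
      linear_combination (f a * (h2 (σ a) - h2 a - f a * h3 a) + F a * h1 (σ a) - F a * h1 a
        + F a ^ 2 * hodd a) / 2
    have h5 : F a = 0 := by simpa [ha] using h4
    have h6 : ∀ y, F y = 0 := by
      intro y
      simpa [h5, ha] using h1 y
    have h7 := heq a a
    rw [h6, h6] at h7
    apply ha
    simpa using h7
  have hFg : ∀ x, F x = M * g x := by
    intro x
    rw [hg, mul_div_cancel₀ _ hM0]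
  have hmul : ∀ x y, f (x * y) = g x * f y + f x * g (σ y) := by
    intro x y
    apply mul_left_cancel₀ hM0
    linear_combination hadd x y + f y * hFg x + f x * hFg (σ y)
  have hcomm : ∀ x y, f (x * y) = f (y * x) := by
    intro x y
    apply mul_left_cancel₀ hM0
    have h := hsub x (σ y)
    rw [hinv] at h
    linear_combination hadd x y - h + F x * hodd y
  have hFcomm : ∀ x y, F (x * y) = F (y * x) := by
    intro x y
    rw [hF, hF]
    refine Finset.sum_congr rfl fun i _ => ?_
    rw [mul_assoc, hcomm, mul_assoc, hcen, mul_assoc]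
  have hFprod : ∀ x y, F (σ (x * y)) = F (x * y) := by
    intro x y
    rcases hmor with hm | hm
    · rw [hm, hFσ]
    · rw [hm, hFσ, hFcomm]
  have hkey : ∀ x y, f y * (g x - g (σ x)) = f x * (g y - g (σ y)) := by
    intro x y
    linear_combination hmul y x - hmul x y + hcomm x y
  have hgσ : ∀ x, g (σ x) = g x := by
    by_contra! hne
    obtain ⟨b, hb⟩ := hne
    have hb' : g b - g (σ b) ≠ 0 := sub_ne_zero.mpr hb.symm
    have h1 : ∀ x y, f (x * y) = 0 := by
      intro x y
      have h := hkey b (x * y)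
      have h' := hFprod x y
      rw [hFg, hFg] at h'
      rw [mul_left_cancel₀ hM0 h', sub_self, mul_zero] at h
      exact (mul_eq_zero.mp h).resolve_right hb'
    have h2 : ∀ x, F x = 0 := by
      intro x
      simp [hF, h1]
    have h3 := heq a a
    rw [h2, h2] at h3
    apply ha
    simpa using h3
  simp only [hgσ] at hmul
  have hP : ∀ x y w, (g (x * y) - g x * g y) * f w = f x * (g (y * w) - g y * g w) := by
    intro x y w
    have h := hmul (x * y) w
    rw [mul_assoc, hmul, hmul, hmul x y] at h
    linear_combination -h
  obtain ⟨κ, hκ⟩ : ∃ κ, ∀ x y, g (x * y) = g x * g y + κ * (f x * f y) := by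
    refine ⟨(g (a * a) - g a * g a) / f a ^ 2, fun x y => ?_⟩
    field_simp
    linear_combination f a * hP x y a + f x * hP y a a
  obtain ⟨b, hb⟩ := IsAlgClosed.exists_pow_nat_eq κ two_pos
  have hχσ : ∀ x, g x = ((g x + b * f x) + (g (σ x) + b * f (σ x))) / 2 := by
    intro x
    rw [hgσ, hodd]
    ring
  refine ⟨fun x => g x + b * f x, ?_, ?_, hχσ⟩
  · intro h0
    have h1 : ∀ x, g x + b * f x = 0 := fun x => congrFun h0 x
    have h2 : ∀ x, g x = 0 := by
      intro x
      rw [hχσ, h1, h1]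
      norm_num
    have h3 := heq a a
    rw [hFg, hFg, h2, h2] at h3
    apply ha
    simpa using h3
  · intro x y
    simp only [hκ, hmul]
    linear_combination -(f x * f y) * hb
end

section
/- A function f : S → ℂ is a non-zero solution of the equation ∫_S f(σ(y)xt) dμ(t) − ∫_S f(xyt) dμ(t) = 2 f(x) f(y) for all x, y ∈ S if and only if f = ((χ∘σ − χ)/2) · ∫_S χ(t) dμ(t) for some multiplicative function χ : S → ℂ (χ(xy) = χ(x)χ(y)) such that ∫_S χ(t) dμ(t) ≠ 0 and ∫_S χ(σ(t)) dμ(t) = −∫_S χ(t) dμ(t). -/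
/-- A nonzero pair of functions satisfying the addition formulas of sine and cosine (up to
scaling) is given by a multiplicative function. -/
theorem exists_multiplicative_of_addition_formulas {S : Type*} [Semigroup S] {f g : S → ℂ} {κ : ℂ}
    (hκ : κ ≠ 0)
    (hf : ∀ x y, κ * f (x * y) = -(f x * g y + f y * g x))
    (hg : ∀ x y, κ * g (x * y) = -(g x * g y + κ * (f x * f y))) :
    ∃ s : ℂ, κ * s ^ 2 = 1 ∧
      ∀ x y, -g (x * y) / κ - s * f (x * y)
        = (-g x / κ - s * f x) * (-g y / κ - s * f y) := by
  obtain ⟨s, hs⟩ := IsAlgClosed.exists_pow_nat_eq (1 / κ) (n := 2) (by norm_num)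
  have hs' : κ * s ^ 2 = 1 := by rw [hs]; field_simp
  refine ⟨s, hs', fun x y => ?_⟩
  have h1 := hf x y
  have h2 := hg x y
  field_simp
  linear_combination (-1) * h2 - s * κ * h1 - κ * f x * f y * hs'

theorem sum_mul_sub_sum_mul {I : Type*} [Fintype I] {c A B u : I → ℂ} {v : ℂ}
    (h : ∀ i, A i - B i = 2 * u i * v) :
    ∑ i, c i * A i - ∑ i, c i * B i = 2 * (∑ i, c i * u i) * v := by
  rw [← Finset.sum_sub_distrib, Finset.mul_sum, Finset.sum_mul]
  exact Finset.sum_congr rfl fun i _ => by linear_combination c i * h i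

/-- The convolution `x ↦ ∫ u (x * t) dμ(t)` of `u` with the discrete measure `∑ i, c i • δ_(w i)`. -/
def discreteConv {S I : Type*} [Semigroup S] [Fintype I] (c : I → ℂ) (w : I → S) (u : S → ℂ)
    (x : S) : ℂ :=
  ∑ i, c i * u (x * w i)

section discreteConv

variable {S I : Type*} [Semigroup S] [Fintype I] {c : I → ℂ} {w : I → S}

theorem discreteConv_mul_of_central (hw : ∀ i s, w i * s = s * w i) (u : S → ℂ) (x y : S) :
    ∑ i, c i * u (x * w i * y) = discreteConv c w u (x * y) := by
  simp only [discreteConv, mul_assoc, hw]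

theorem discreteConv_comm_of_central {v : I → S} (hw : ∀ i s, w i * s = s * w i) (u : S → ℂ)
    (x : S) :
    discreteConv c w (discreteConv c v u) x = discreteConv c v (discreteConv c w u) x := by
  simp only [discreteConv, Finset.mul_sum]
  rw [Finset.sum_comm]
  refine Finset.sum_congr rfl fun i _ => Finset.sum_congr rfl fun j _ => ?_
  rw [mul_assoc x, mul_assoc x, hw]
  ring

end discreteConv

/-- The forward direction of the classification of solutions. -/
theorem exists_multiplicative_of_integral_van_vleck {S : Type*} [Semigroup S] {σ : S → S}
    (hmor : (∀ x y : S, σ (x * y) = σ x * σ y) ∨ (∀ x y : S, σ (x * y) = σ y * σ x))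
    (hinv : ∀ x : S, σ (σ x) = x)
    {I : Type*} [Fintype I] {c : I → ℂ} {z : I → S}
    (hcen : ∀ i : I, ∀ s : S, z i * s = s * z i)
    {f : S → ℂ} (hf0 : f ≠ 0)
    (hf : ∀ x y : S, discreteConv c z f (σ y * x) - discreteConv c z f (x * y)
        = 2 * f x * f y) :
    ∃ χ : S → ℂ, (∀ x y : S, χ (x * y) = χ x * χ y) ∧
      (∑ i, c i * χ (z i)) ≠ 0 ∧
      (∑ i, c i * χ (σ (z i))) = - (∑ i, c i * χ (z i)) ∧
      ∀ x : S, f x = (χ (σ x) - χ x) / 2 * (∑ i, c i * χ (z i)) := by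
  obtain ⟨a, ha⟩ := Function.ne_iff.mp hf0
  replace ha : f a ≠ 0 := ha
  have hcen' : ∀ i s, σ (z i) * s = s * σ (z i) := fun i s => by
    have := congrArg σ (hcen i (σ s))
    rcases hmor with h | h
    · simpa [h, hinv] using this
    · simpa [h, hinv] using this.symm
  have hσz : ∀ x i, σ (x * z i) = σ x * σ (z i) := fun x i => by
    rcases hmor with h | h
    · exact h _ _
    · rw [h, hcen']
  have hσz' : ∀ x i, σ (x * σ (z i)) = σ x * z i := fun x i => by
    rcases hmor with h | h
    · rw [h, hinv]
    · rw [h, hinv, hcen]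
  set g := discreteConv c z f with hgdef
  set g' := discreteConv c (fun i => σ (z i)) f with hg'def
  set h := discreteConv c z g with hhdef
  set k := discreteConv c (fun i => σ (z i)) g with hkdef
  -- `f` is odd.
  have hodd : ∀ x, f (σ x) = -f x := by
    have key : ∀ x y, (f x + f (σ x)) * (f y + f (σ y)) = 0 := fun x y => by
      have e1 := hf x y
      have e2 := hf (σ y) x
      have e3 := hf (σ x) (σ y)
      have e4 := hf y (σ x)
      simp only [hinv] at e3 e4
      linear_combination (-1 / 2 : ℂ) * (e1 + e2 + e3 + e4)
    intro x
    have := mul_self_eq_zero.mp (key x x)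
    linear_combination this
  have hgσσ : ∀ x y, g (σ x * σ y) = g (x * y) := fun x y => by
    have e1 := hf x y
    have e2 := hf (σ y) x
    rw [hodd] at e2
    linear_combination e1 + e2
  have hg0 : ∃ b, g b ≠ 0 := by
    by_contra! hg
    have := hf a a
    simp [hg, ha] at this
  have hg'σ : ∀ x, g (σ x) = -g' x := fun x => by
    simp only [hgdef, hg'def, discreteConv, ← Finset.sum_neg_distrib]
    refine Finset.sum_congr rfl fun i _ => ?_
    rw [← hσz', hodd]; ring
  have e1 : ∀ x y, h (σ y * x) - h (x * y) = 2 * g x * f y := fun x y => by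
    rw [hhdef, ← discreteConv_mul_of_central hcen g x y]
    exact sum_mul_sub_sum_mul fun i => by rw [mul_assoc (σ y), hf]
  have e2 : ∀ x y, k (σ y * x) - h (x * y) = 2 * f x * g y := fun x y => by
    rw [hkdef, ← discreteConv_mul_of_central hcen' g (σ y) x, mul_right_comm]
    exact sum_mul_sub_sum_mul fun i => by rw [mul_assoc x, ← hσz, hf, mul_right_comm]
  have e3 : ∀ x y, k (σ y * x) - k (x * y) = 2 * g' x * f y := fun x y => by
    rw [hkdef, ← discreteConv_mul_of_central hcen' g x y]
    exact sum_mul_sub_sum_mul fun i => by rw [mul_assoc (σ y), hf]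
  have e4 : ∀ x y, h (σ y * x) - k (x * y) = 2 * f x * g' y := fun x y => by
    rw [hhdef, ← discreteConv_mul_of_central hcen g (σ y) x, mul_right_comm]
    exact sum_mul_sub_sum_mul fun i => by rw [mul_assoc x, ← hσz', hf, mul_right_comm]
  -- `g` is even.
  obtain ⟨l, hl⟩ : ∃ l : ℂ, ∀ x, g x + g' x = l * f x := by
    refine ⟨(g a + g' a) / f a, fun x => ?_⟩
    field_simp
    linear_combination (-1 / 2 : ℂ) * (e2 a x - e3 a x - e1 a x + e4 a x)
  have hl0 : l = 0 := by
    by_contra hl0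
    obtain ⟨b, hb⟩ := hg0
    have hfz : ∀ i, f (b * z i) = 0 := fun i => by
      have h1 := hl (b * z i)
      have h2 := hg'σ (b * z i)
      rw [hσz, hgσσ] at h2
      have : l * f (b * z i) = 0 := by linear_combination h2 - h1
      exact (mul_eq_zero.mp this).resolve_left hl0
    exact hb (by simp [hgdef, discreteConv, hfz])
  have hg' : ∀ x, g' x = -g x := fun x => by
    have := hl x
    rw [hl0] at this
    linear_combination this
  have heven : ∀ x, g (σ x) = g x := fun x => by rw [hg'σ, hg', neg_neg]
  have hhxy : ∀ x y, h (x * y) = -(f x * g y + f y * g x) := fun x y => by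
    have hk : k (x * y) = -h (x * y) := by
      rw [hkdef, hgdef, discreteConv_comm_of_central hcen', ← hg'def, hhdef]
      simp [discreteConv, hg']
    have := e3 x y
    rw [hk, hg'] at this
    linear_combination (1 / 2 : ℂ) * (this - e2 x y)
  have hHxy : ∀ x y, discreteConv c z h (x * y) = -(g x * g y + f y * h x) := fun x y => by
    rw [← discreteConv_mul_of_central hcen h x y]
    have : h x = ∑ i, c i * g (x * z i) := rfl
    rw [this]
    have : g x = ∑ i, c i * f (x * z i) := rfl
    rw [this, Finset.sum_mul, Finset.mul_sum, ← Finset.sum_add_distrib, ← Finset.sum_neg_distrib]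
    refine Finset.sum_congr rfl fun i _ => ?_
    rw [hhxy]; ring
  have hHxy' : ∀ x y, discreteConv c z h (x * y) = -(g x * g y + f x * h y) := fun x y => by
    have : h y = ∑ i, c i * g (y * z i) := rfl
    rw [this]
    have : g y = ∑ i, c i * f (y * z i) := rfl
    rw [this, Finset.mul_sum, Finset.mul_sum, ← Finset.sum_add_distrib, ← Finset.sum_neg_distrib]
    refine Finset.sum_congr rfl fun i _ => ?_
    rw [mul_assoc x, hhxy]; ring
  obtain ⟨κ, hκ⟩ : ∃ κ : ℂ, ∀ x, h x = κ * f x := by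
    refine ⟨h a / f a, fun x => ?_⟩
    field_simp
    linear_combination hHxy x a - hHxy' x a
  have hHκ : ∀ x, discreteConv c z h x = κ * g x := fun x => by
    simp only [hgdef, discreteConv, hκ, Finset.mul_sum]
    exact Finset.sum_congr rfl fun i _ => by ring
  have hgadd : ∀ x y, κ * g (x * y) = -(g x * g y + κ * (f x * f y)) := fun x y => by
    rw [← hHκ, hHxy, hκ]; ring
  have hfadd : ∀ x y, κ * f (x * y) = -(f x * g y + f y * g x) := fun x y => by
    rw [← hκ, hhxy]
  have hκ0 : κ ≠ 0 := by
    rintro rfl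
    obtain ⟨b, hb⟩ := hg0
    have := hgadd b b
    simp [hb] at this
  obtain ⟨s, hs, hmul⟩ := exists_multiplicative_of_addition_formulas hκ0 hfadd hgadd
  have hs0 : s ≠ 0 := by rintro rfl; simp at hs
  -- The integrals of `f` and `g`.
  have hsum : ∀ x, κ * g x = -(f x * (∑ i, c i * g (z i)) + g x * ∑ i, c i * f (z i)) := fun x => by
    have : g x = ∑ i, c i * f (x * z i) := rfl
    rw [this, Finset.mul_sum, ← this, Finset.mul_sum, Finset.mul_sum, ← Finset.sum_add_distrib,
      ← Finset.sum_neg_distrib]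
    refine Finset.sum_congr rfl fun i _ => ?_
    linear_combination c i * hfadd x (z i)
  have hsum_g : ∑ i, c i * g (z i) = 0 := by
    have h1 := hsum a
    have h2 := hsum (σ a)
    rw [heven, hodd] at h2
    have : f a * ∑ i, c i * g (z i) = 0 := by linear_combination (1 / 2 : ℂ) * (h1 - h2)
    exact (mul_eq_zero.mp this).resolve_left ha
  have hsum_f : ∑ i, c i * f (z i) = -κ := by
    obtain ⟨b, hb⟩ := hg0
    have h1 := hsum b
    rw [hsum_g] at h1
    apply mul_left_cancel₀ hb
    linear_combination h1
  have hlin : ∀ r : ℂ, ∑ i, c i * (-g (z i) / κ - r * f (z i)) = r * κ := fun r => by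
    have : ∀ i, c i * (-g (z i) / κ - r * f (z i))
        = (-1 / κ) * (c i * g (z i)) - r * (c i * f (z i)) := fun i => by ring
    simp only [this, Finset.sum_sub_distrib, ← Finset.mul_sum, hsum_g, hsum_f]
    ring
  refine ⟨fun x => -g x / κ - s * f x, hmul, ?_, ?_, fun x => ?_⟩
  · rw [hlin]; exact mul_ne_zero hs0 hκ0
  · have := hlin (-s)
    simp only [heven, hodd, hlin]
    simp only [neg_mul, mul_neg] at this ⊢
    exact this
  · simp only [heven, hodd, hlin]
    linear_combination -f x * hs

theorem stmt10 {S : Type*} [Semigroup S] (σ : S → S)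
    (hmor : (∀ x y : S, σ (x * y) = σ x * σ y) ∨ (∀ x y : S, σ (x * y) = σ y * σ x))
    (hinv : ∀ x : S, σ (σ x) = x)
    {I : Type*} [Fintype I] (c : I → ℂ) (z : I → S)
    (hcen : ∀ i : I, ∀ s : S, z i * s = s * z i)
    (f : S → ℂ) :
    (f ≠ 0 ∧ ∀ x y : S, (∑ i, c i * f (σ y * x * z i)) - (∑ i, c i * f (x * y * z i))
        = 2 * f x * f y) ↔
    (∃ χ : S → ℂ, (∀ x y : S, χ (x * y) = χ x * χ y) ∧
      (∑ i, c i * χ (z i)) ≠ 0 ∧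
      (∑ i, c i * χ (σ (z i))) = - (∑ i, c i * χ (z i)) ∧
      ∀ x : S, f x = (χ (σ x) - χ x) / 2 * (∑ i, c i * χ (z i))) := by
  have hχσ : ∀ χ : S → ℂ, (∀ x y : S, χ (x * y) = χ x * χ y) →
      ∀ x y, χ (σ (x * y)) = χ (σ x) * χ (σ y) := fun χ hχ x y => by
    rcases hmor with h | h
    · rw [h, hχ]
    · rw [h, hχ, mul_comm]
  constructor
  · rintro ⟨hf0, hf⟩
    exact exists_multiplicative_of_integral_van_vleck hmor hinv hcen hf0 hf
  · rintro ⟨χ, hχ, hm0, hmσ, hfχ⟩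
    refine ⟨?_, fun x y => ?_⟩
    · rintro rfl
      have hχeq : ∀ x, χ (σ x) = χ x := fun x => by
        have := (mul_eq_zero.mp (hfχ x).symm).resolve_right hm0
        linear_combination 2 * this
      simp only [hχeq] at hmσ
      exact hm0 (self_eq_neg.mp hmσ)
    · set m := ∑ i, c i * χ (z i) with hm
      have hconv : ∀ u : S, ∑ i, c i * f (u * z i) = -(m ^ 2 / 2) * (χ (σ u) + χ u) := fun u => by
        have : ∀ i, c i * f (u * z i) = m / 2 * χ (σ u) * (c i * χ (σ (z i)))
            - m / 2 * χ u * (c i * χ (z i)) := fun i => by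
          rw [hfχ, hχσ χ hχ, hχ]; ring
        simp only [this, Finset.sum_sub_distrib, ← Finset.mul_sum, hmσ, ← hm]
        ring
      rw [hconv, hconv, hχσ χ hχ, hχσ χ hχ, hχ, hχ, hinv, hfχ x, hfχ y]
      ring
end

section
/- Let M be a monoid, σ : M → M an involutive automorphism (σ(xy) = σ(x)σ(y), σ(σ(x)) = x), and z₀ a fixed element of the center of M. A function f : M → ℂ is a non-zero solution of f(σ(y)x z₀) − f(x y z₀) = 2 f(x) f(y) for all x, y ∈ M if and only if f = χ(z₀) · (χ∘σ − χ)/2 for some multiplicative function χ : M → ℂ with χ(z₀) ≠ 0 and χ(σ(z₀)) = −χ(z₀). -/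
theorem stmt11 {M : Type*} [Monoid M] (σ : M → M)
    (hmor : ∀ x y : M, σ (x * y) = σ x * σ y)
    (hinv : ∀ x : M, σ (σ x) = x)
    (z₀ : M) (hz₀ : ∀ s : M, z₀ * s = s * z₀)
    (f : M → ℂ) :
    (f ≠ 0 ∧ ∀ x y : M, f (σ y * x * z₀) - f (x * y * z₀) = 2 * f x * f y) ↔
    (∃ χ : M → ℂ, (∀ x y : M, χ (x * y) = χ x * χ y) ∧
      χ z₀ ≠ 0 ∧ χ (σ z₀) = - χ z₀ ∧
      ∀ x : M, f x = χ z₀ * ((χ (σ x) - χ x) / 2)) := by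
  have h_one : σ 1 = 1 := by
    have h := hmor 1 (σ 1)
    rw [one_mul, hinv, mul_one] at h
    exact h.symm
  constructor
  · rintro ⟨hne, hf⟩
    obtain ⟨t, ht⟩ : ∃ t, f t ≠ 0 := Function.ne_iff.mp hne
    have odd : ∀ x, f (σ x) = -f x := by
      have key : ∀ x y, f (σ x * y * z₀) - f (x * σ y * z₀) = 2 * f x * (f y + f (σ y)) := by
        intro x y
        have h₁ := hf x (σ y)
        have h₂ := hf y x
        rw [hinv] at h₁
        linear_combination h₁ + h₂
      have prod : ∀ x y, (f x + f (σ x)) * (f y + f (σ y)) = 0 := by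
        intro x y
        have h₁ := key x y
        have h₂ := key (σ x) (σ y)
        rw [hinv, hinv] at h₂
        linear_combination -(h₁ + h₂) / 2
      intro x
      linear_combination mul_self_eq_zero.mp (prod x x)
    have f_one : f 1 = 0 := by
      have h := odd 1
      rw [h_one] at h
      linear_combination h / 2
    have even_shift : ∀ y, f (σ y * z₀) = f (y * z₀) := by
      intro y
      have h := hf 1 y
      rw [f_one, mul_one, one_mul] at h
      linear_combination h
    have shift_sigma : ∀ y, f (y * σ z₀) = -f (y * z₀) := by
      intro y
      have h := odd (σ y * z₀)
      rw [hmor, hinv, even_shift] at h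
      exact h
    have sigma_comm : ∀ x, σ z₀ * x = x * σ z₀ := by
      intro x
      have h := congrArg σ (hz₀ (σ x))
      simpa only [hmor, hinv] using h
    have shift_shift : ∀ x, f (x * z₀ * z₀) = -f z₀ * f x := by
      intro x
      have h := hf x z₀
      rw [sigma_comm, mul_assoc x, sigma_comm, ← mul_assoc, shift_sigma] at h
      linear_combination -h / 2
    have shift_right : ∀ x y, x * z₀ * y = x * y * z₀ := by
      intro x y
      rw [mul_assoc, hz₀, ← mul_assoc]
    have hfz : f z₀ ≠ 0 := by
      intro h0
      have hzz : ∀ x, f (x * z₀ * z₀) = 0 := fun x => by rw [shift_shift, h0]; ring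
      have hz : ∀ x, f (x * z₀) = 0 := by
        intro x
        have h := hf (x * z₀) t
        rw [shift_right, ← mul_assoc, hzz, hzz] at h
        have h' : f (x * z₀) * f t = 0 := by linear_combination -h / 2
        exact (mul_eq_zero.mp h').resolve_right ht
      have h := hf t t
      rw [hz, hz] at h
      exact ht (mul_self_eq_zero.mp (by linear_combination -h / 2))
    have add_cos : ∀ x y, f z₀ * f (x * y * z₀) = f (x * z₀) * f (y * z₀) - f z₀ * f x * f y := by
      intro x y
      have h := hf (x * z₀) (y * z₀)
      have e₁ : σ (y * z₀) * (x * z₀) * z₀ = σ y * x * z₀ * z₀ * σ z₀ := by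
        rw [hmor, mul_assoc (σ y), sigma_comm, mul_assoc (σ y * _), mul_assoc (σ y)]
        simp only [mul_assoc, sigma_comm]
      have e₂ : x * z₀ * (y * z₀) * z₀ = x * y * z₀ * z₀ * z₀ := by
        rw [shift_right, ← mul_assoc]
      rw [e₁, e₂, shift_sigma, shift_shift, shift_shift] at h
      linear_combination h / 2 - f z₀ / 2 * hf x y
    have add_sin : ∀ x y, f z₀ * f (x * y) = f x * f (y * z₀) + f (x * z₀) * f y := by
      intro x y
      have h := add_cos (x * z₀) y
      rw [shift_right, shift_shift, shift_shift] at h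
      apply mul_left_cancel₀ hfz
      linear_combination -h
    obtain ⟨c, hc⟩ : ∃ c : ℂ, -f z₀ = c * c := IsAlgClosed.exists_eq_mul_self _
    have hc0 : c ≠ 0 := by
      rintro rfl
      exact hfz (by linear_combination -hc)
    have hfc : f z₀ = -(c * c) := by linear_combination -hc
    have hχz : -f (z₀ * z₀) / c ^ 2 - f z₀ / c = c := by
      have h := shift_shift 1
      rw [one_mul, f_one, mul_zero] at h
      rw [h, hfc]
      field_simp
      ring
    refine ⟨fun x => -f (x * z₀) / c ^ 2 - f x / c, ?_, ?_, ?_, ?_⟩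
    · intro x y
      have h₁ := add_cos x y
      have h₂ := add_sin x y
      rw [hfc] at h₁ h₂
      field_simp
      linear_combination h₁ + c * h₂
    · simpa only [hχz] using hc0
    · have h := shift_shift 1
      rw [one_mul, f_one, mul_zero] at h
      simp only [even_shift, odd, h, hfc]
      field_simp
      ring
    · intro x
      simp only [hχz, even_shift, odd]
      field_simp
      ring
  · rintro ⟨χ, hχ, hz, hσz, hf⟩
    refine ⟨fun h0 => ?_, fun x y => ?_⟩
    · have h := hf z₀
      rw [h0, hσz, Pi.zero_apply] at h
      exact hz (mul_self_eq_zero.mp (by linear_combination h))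
    · simp only [hf, hmor, hχ, hinv, hσz]
      ring
end

section
/- Let S be a group (or, more generally, a monoid), σ : S → S an involutive morphism, and μ = Σ_{i∈I} c_i δ_{z_i} a finite linear combination of Dirac measures at central points. If a non-zero f : S → ℂ satisfies ∫_S f(σ(y)xt) dμ(t) − ∫_S f(xyt) dμ(t) = 2 f(x) f(y) for all x, y, then f(σ(y)x) + f(xy) = 2 f(x) g(y) and f(xy) − f(σ(y)x) = 2 f(y) g(x) for all x, y ∈ S, where g(x) := (∫_S f(xt) dμ(t)) / (∫_S f(t) dμ(t)). -/
theorem stmt12 {S : Type*} [Monoid S] (σ : S → S)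
    (hmor : (∀ x y : S, σ (x * y) = σ x * σ y) ∨ (∀ x y : S, σ (x * y) = σ y * σ x))
    (hinv : ∀ x : S, σ (σ x) = x)
    {I : Type*} [Fintype I] (c : I → ℂ) (z : I → S)
    (hcen : ∀ i : I, ∀ s : S, z i * s = s * z i)
    (f : S → ℂ) (hf : f ≠ 0)
    (heq : ∀ x y : S, (∑ i, c i * f (σ y * x * z i)) - (∑ i, c i * f (x * y * z i))
      = 2 * f x * f y)
    (g : S → ℂ)
    (hg : ∀ x : S, g x = (∑ i, c i * f (x * z i)) / (∑ i, c i * f (z i))) :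
    ∀ x y : S, f (σ y * x) + f (x * y) = 2 * f x * g y ∧
      f (x * y) - f (σ y * x) = 2 * f y * g x := by
  obtain ⟨F, hF⟩ : ∃ F : S → ℂ, ∀ x, F x = ∑ i, c i * f (x * z i) := ⟨_, fun _ => rfl⟩
  obtain ⟨G, hG⟩ : ∃ G : S → ℂ, ∀ x, G x = ∑ i, c i * F (x * z i) := ⟨_, fun _ => rfl⟩
  have hF_eq : ∀ x y, F (σ y * x) - F (x * y) = 2 * f x * f y := by
    intro x y
    rw [hF, hF]
    exact heq x y
  have hG_eq : ∀ x y, G (σ y * x) - G (x * y) = 2 * F x * f y := by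
    intro x y
    rw [hG, hG, hF x, ← Finset.sum_sub_distrib, Finset.mul_sum, Finset.sum_mul]
    refine Finset.sum_congr rfl fun i _ => ?_
    have h := hF_eq (x * z i) y
    rw [← mul_assoc, mul_assoc x, hcen i y, ← mul_assoc] at h
    linear_combination c i * h
  obtain ⟨a, ha⟩ : ∃ a, f a ≠ 0 := Function.ne_iff.mp hf
  have hσ_one : σ 1 = 1 := by
    rcases hmor with h | h
    · simpa [hinv] using (h 1 (σ 1)).symm
    · simpa [hinv] using (h (σ 1) 1).symm
  have hf_one : f 1 = 0 := by
    have h := hF_eq a 1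
    simp only [hσ_one, one_mul, mul_one, sub_self] at h
    simpa [ha] using h.symm
  have hFσ : ∀ y, F (σ y) = F y := by
    intro y
    have h := hF_eq 1 y
    simp only [mul_one, one_mul, hf_one] at h
    linear_combination h
  have hF_comm : (∀ x y, σ (x * y) = σ y * σ x) → ∀ x y, F (x * y) = F (y * x) := by
    intro h x y
    have h1 := hFσ (σ y * x)
    rw [h, hinv] at h1
    linear_combination hF_eq y x - hF_eq x y - h1
  have hG_comm : (∀ x y, σ (x * y) = σ y * σ x) → ∀ x y, G (x * y) = G (y * x) := by
    intro h x y
    rw [hG, hG]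
    refine Finset.sum_congr rfl fun i _ => ?_
    rw [mul_assoc, hF_comm h, mul_assoc, hcen i x, ← mul_assoc]
  have hGσ : ∀ y, G (σ y) - G y = 2 * F 1 * f y := by
    intro y
    simpa using hG_eq 1 y
  have hfσ : ∀ y, f (σ y) = - f y := by
    intro y
    apply mul_left_cancel₀ ha
    have h2 := hF_eq a (σ y)
    rw [hinv] at h2
    rcases hmor with h | h
    · have h3 := hF_eq y a
      have h4 := hFσ (a * σ y)
      rw [h, hinv] at h4
      linear_combination (-h2 - h3 + h4) / 2
    · have h1 := hF_eq a y
      rw [hF_comm h y a, hF_comm h a (σ y)] at h2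
      linear_combination (-h1 - h2) / 2
  have hF_one : F 1 ≠ 0 := by
    intro h0
    have hGσ' : ∀ y, G (σ y) = G y := by
      intro y
      linear_combination hGσ y + 2 * f y * h0
    have hF_zero : ∀ x, F x = 0 := by
      intro x
      have h1 := hG_eq x a
      have h2 := hG_eq (σ x) (σ a)
      have h3 := hGσ' (σ a * x)
      have h4 := hGσ' (x * a)
      rw [hinv, hFσ, hfσ] at h2
      refine (mul_eq_zero.mp (?_ : F x * f a = 0)).resolve_right ha
      rcases hmor with h | h
      · rw [h, hinv] at h3
        rw [h] at h4
        linear_combination (h4 - h3 + h2 - h1) / 4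
      · rw [h, hinv, hG_comm h] at h3
        rw [h, hG_comm h] at h4
        linear_combination (h4 - h3 + h2 - h1) / 4
    have h := hF_eq a a
    rw [hF_zero, hF_zero] at h
    simp [ha] at h
  have hgF : ∀ x, g x * F 1 = F x := by
    intro x
    have h1 : F 1 = ∑ i, c i * f (z i) := by simp [hF]
    rw [hg, ← hF, ← h1, div_mul_cancel₀ _ hF_one]
  have hgσ : ∀ x, g (σ x) = g x := by
    intro x
    apply mul_right_cancel₀ hF_one
    rw [hgF, hgF, hFσ]
  have hsub : ∀ x y, f (x * y) - f (σ y * x) = 2 * f y * g x := by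
    intro x y
    apply mul_right_cancel₀ hF_one
    have h1 := hGσ (x * y)
    have h2 := hGσ (σ y * x)
    have h3 := hG_eq x y
    have h4 := hG_eq (σ x) (σ y)
    rw [hinv, hFσ, hfσ] at h4
    rcases hmor with h | h
    · rw [h] at h1 h2
      rw [hinv] at h2
      linear_combination (h3 - h4 - h1 + h2) / 2 - 2 * f y * hgF x
    · rw [h, hG_comm h (σ y) (σ x)] at h1
      rw [h, hinv, hG_comm h (σ x) y] at h2
      linear_combination (h3 - h4 - h1 + h2) / 2 - 2 * f y * hgF x
  intro x y
  refine ⟨?_, hsub x y⟩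
  have h1 := hsub (σ y) x
  rw [hgσ] at h1
  rcases hmor with h | h
  · have h3 := hfσ (x * y)
    rw [h] at h3
    linear_combination h1 + h3
  · have h4 := hfσ (y * x)
    have h5 : f (x * y) = f (y * x) := by
      apply mul_left_cancel₀ hF_one
      have h6 := hGσ (x * y)
      have h7 := hGσ (y * x)
      rw [h, hG_comm h, hG_comm h x] at h6
      rw [h] at h7
      linear_combination (h7 - h6) / 2
    rw [h] at h4
    linear_combination h1 + h4 + h5
end

section
/- Let S be a locally compact topological semigroup and υ a complex Borel measure on S with compact support. A continuous function f : S → ℂ satisfies ∫_S f(xyt) dυ(t) = f(x) f(y) for all x, y ∈ S if and only if f = χ · ∫_S χ(t) dυ(t) for some continuous multiplicative function χ : S → ℂ (χ(xy) = χ(x)χ(y)). -/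
open MeasureTheory

theorem stmt13 {S : Type*} [Semigroup S] [TopologicalSpace S] [ContinuousMul S]
    [LocallyCompactSpace S] [MeasurableSpace S] [BorelSpace S]
    (ν : Measure S) [IsFiniteMeasure ν] (w : S → ℂ) (hw : Integrable w ν)
    (hsupp : ∃ K : Set S, IsCompact K ∧ ν Kᶜ = 0)
    (f : S → ℂ) (hf : Continuous f) :
    (∀ x y : S, (∫ t, w t * f (x * y * t) ∂ν) = f x * f y) ↔
    (∃ χ : S → ℂ, Continuous χ ∧ (∀ x y : S, χ (x * y) = χ x * χ y) ∧
      ∀ x : S, f x = χ x * ∫ t, w t * χ t ∂ν) := by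
  constructor
  · intro h
    by_cases h0 : ∀ x, f x = 0
    · exact ⟨fun _ => 0, continuous_const, by simp, by simpa using h0⟩
    push Not at h0
    obtain ⟨c, hc⟩ := h0
    -- Both sides equal the integral of `t ↦ w t * f (x * y * z * t)`.
    have hshift (x y z : S) : f x * f (y * z) = f (x * y) * f z := by
      rw [← h, ← h]
      simp only [mul_assoc]
    have hmul (x y : S) : f (x * y) = f x * (f (y * c) / f c) := by
      rw [mul_div_assoc', eq_div_iff hc, hshift]
    have hχ (x y : S) : f (x * y * c) / f c = f (x * c) / f c * (f (y * c) / f c) := by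
      apply mul_left_cancel₀ hc
      rw [← mul_assoc, ← hmul, ← hmul, ← hmul, mul_assoc]
    refine ⟨fun y => f (y * c) / f c, by fun_prop, hχ, fun y => ?_⟩
    apply mul_left_cancel₀ hc
    rw [← h, ← mul_assoc, ← hmul, ← integral_const_mul]
    congr 1 with t
    rw [hmul (c * y) t]
    ring
  · rintro ⟨χ, -, hχ, hfχ⟩ x y
    simp only [hfχ, hχ]
    generalize hC : ∫ t, w t * χ t ∂ν = C
    calc ∫ t, w t * (χ x * χ y * χ t * C) ∂ν
        = ∫ t, (χ x * χ y * C) * (w t * χ t) ∂ν := by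
          congr 1 with t
          ring
      _ = χ x * C * (χ y * C) := by
          rw [integral_const_mul, hC]
          ring
end

section
/- Let S be a locally compact topological semigroup, σ : S → S a continuous involutive automorphism (σ(xy) = σ(x)σ(y), σ(σ(x)) = x), and υ a complex Borel measure on S with compact support which is σ-invariant, i.e., ∫_S h(σ(t)) dυ(t) = ∫_S h(t) dυ(t) for every continuous h : S → ℂ. A continuous function f : S → ℂ satisfies ∫_S f(xty) dυ(t) + ∫_S f(σ(y)tx) dυ(t) = 2 f(x) f(y) for all x, y ∈ S if and only if f = (ψ + ψ∘σ)/2 for some continuous υ-spherical function ψ : S → ℂ, i.e., ψ satisfying ∫_S ψ(xsy) dυ(s) = ψ(x) ψ(y) for all x, y ∈ S. -/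
open MeasureTheory

section CompactlySupportedMeasure

variable {S Y : Type*} [TopologicalSpace S] [TopologicalSpace Y]
  [MeasurableSpace S] [BorelSpace S]
  {ν : Measure S} {w : S → ℂ}

lemma integrable_mul_of_continuous (hw : Integrable w ν)
    (hsupp : ∃ K : Set S, IsCompact K ∧ ν Kᶜ = 0) {g : S → ℂ} (hg : Continuous g) :
    Integrable (fun t => w t * g t) ν := by
  obtain ⟨K, hK, hν⟩ := hsupp
  obtain ⟨C, hC⟩ := hK.exists_bound_of_continuousOn hg.continuousOn
  refine hw.mul_bdd (c := C) hg.measurable.aestronglyMeasurable ?_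
  filter_upwards [measure_eq_zero_iff_ae_notMem.1 hν] with t ht
  exact hC t (by simpa using ht)

/-- Integration against a density supported in a compact set `K` is a continuous functional
on `C(K, ℂ)`; here `K` need not be measurable. -/
lemma exists_clm_integral (hw : Integrable w ν) {K : Set S} [CompactSpace K]
    (hν : ν Kᶜ = 0) :
    ∃ L : C(K, ℂ) →L[ℂ] ℂ, ∀ g : C(S, ℂ), L (g.restrict K) = ∫ t, w t * g t ∂ν := by
  obtain ⟨N, hKN, hNm, hN⟩ := exists_measurable_superset_of_null hν
  have hsub : Nᶜ ⊆ K := Set.compl_subset_comm.1 hKN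
  set μ : Measure (Nᶜ : Set S) := ν.comap Subtype.val
  have hM : MeasurableSet Nᶜ := hNm.compl
  have hwμ : Integrable (fun t : (Nᶜ : Set S) => w t) μ :=
    ((MeasurableEmbedding.subtype_coe hM).integrable_map_iff (g := w)).1
      (by rw [map_comap_subtype_coe hM]; exact hw.restrict)
  have hb : ∀ g : C(K, ℂ),
      Integrable (fun t : (Nᶜ : Set S) => w t * g (Set.inclusion hsub t)) μ := fun g =>
    hwμ.mul_bdd (c := ‖g‖)
      (g.continuous.comp (continuous_inclusion hsub)).measurable.aestronglyMeasurable
      (Filter.Eventually.of_forall fun t => g.norm_coe_le_norm _)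
  refine ⟨LinearMap.mkContinuous
    { toFun := fun g => ∫ t, w t * g (Set.inclusion hsub t) ∂μ
      map_add' := fun g h => ?_
      map_smul' := fun c g => ?_ } (∫ t, ‖w t‖ ∂μ) fun g => ?_, fun g => ?_⟩
  · rw [← integral_add (hb g) (hb h)]
    simp [mul_add]
  · simp only [RingHom.id_apply, smul_eq_mul]
    rw [← integral_const_mul]
    congr 1
    ext t
    simp [mul_left_comm]
  · rw [← integral_mul_const]
    refine norm_integral_le_of_norm_le (hwμ.norm.mul_const _)
      (Filter.Eventually.of_forall fun t => ?_)
    rw [norm_mul]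
    exact mul_le_mul_of_nonneg_left (g.norm_coe_le_norm _) (norm_nonneg _)
  · refine (integral_subtype_comap (μ := ν) hM (fun t => w t * g t)).trans ?_
    rw [Measure.restrict_eq_self_of_ae_mem]
    exact measure_eq_zero_iff_ae_notMem.1 hN

lemma continuous_integral_mul (hw : Integrable w ν)
    (hsupp : ∃ K : Set S, IsCompact K ∧ ν Kᶜ = 0) {F : Y → S → ℂ}
    (hF : Continuous (Function.uncurry F)) :
    Continuous fun y => ∫ t, w t * F y t ∂ν := by
  obtain ⟨K, hK, hν⟩ := hsupp
  have : CompactSpace K := isCompact_iff_compactSpace.1 hK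
  obtain ⟨L, hL⟩ := exists_clm_integral hw hν
  let G : C(Y, C(S, ℂ)) := ContinuousMap.curry ⟨_, hF⟩
  have : (fun y => ∫ t, w t * F y t ∂ν) = fun y => L ((G y).restrict K) :=
    funext fun y => (hL (G y)).symm
  rw [this]
  exact L.continuous.comp ((ContinuousMap.continuous_restrict K).comp G.continuous)

/-- Fubini for continuous functions: no second countability is assumed. -/
lemma integral_mul_integral_mul_swap (hw : Integrable w ν)
    (hsupp : ∃ K : Set S, IsCompact K ∧ ν Kᶜ = 0) {F : S → S → ℂ}
    (hF : Continuous (Function.uncurry F)) :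
    ∫ s, w s * ∫ t, w t * F s t ∂ν ∂ν = ∫ t, w t * ∫ s, w s * F s t ∂ν ∂ν := by
  have hcont : Continuous fun t => ∫ s, w s * F s t ∂ν :=
    continuous_integral_mul hw hsupp (F := fun t s => F s t) (hF.comp continuous_swap)
  obtain ⟨K, hK, hν⟩ := hsupp
  have : CompactSpace K := isCompact_iff_compactSpace.1 hK
  obtain ⟨L, hL⟩ := exists_clm_integral hw hν
  let G : C(S, C(S, ℂ)) := ContinuousMap.curry ⟨_, hF⟩
  let H : S → C(K, ℂ) := fun s => (G s).restrict K
  have hH : Continuous H := (ContinuousMap.continuous_restrict K).comp G.continuous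
  have hKae : ∀ᵐ s ∂ν, s ∈ K := by
    filter_upwards [measure_eq_zero_iff_ae_notMem.1 hν] with t ht
    simpa using ht
  have hHm : AEStronglyMeasurable H ν := by
    borelize C(K, ℂ)
    refine aestronglyMeasurable_iff_aemeasurable_separable.2
      ⟨hH.measurable.aemeasurable, H '' K, (hK.image hH).isSeparable, ?_⟩
    filter_upwards [hKae] with s hs using Set.mem_image_of_mem _ hs
  obtain ⟨C, hC⟩ := hK.exists_bound_of_continuousOn hH.continuousOn
  have hint : Integrable (fun s => w s • H s) ν := by
    refine (hw.norm.mul_const C).mono' (hw.aestronglyMeasurable.smul hHm) ?_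
    filter_upwards [hKae] with s hs
    rw [norm_smul]
    exact mul_le_mul_of_nonneg_left (hC s hs) (norm_nonneg _)
  have hrestrict : ∫ s, w s • H s ∂ν =
      (⟨_, hcont⟩ : C(S, ℂ)).restrict K := by
    ext t
    rw [← ContinuousMap.evalCLM_apply ℂ t, ← ContinuousLinearMap.integral_comp_comm _ hint]
    rfl
  calc ∫ s, w s * ∫ t, w t * F s t ∂ν ∂ν = ∫ s, L (w s • H s) ∂ν := by
        congr 1
        ext s
        rw [map_smul, hL (G s)]
        rfl
    _ = L (∫ s, w s • H s ∂ν) := L.integral_comp_comm hint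
    _ = _ := by rw [hrestrict, hL]; rfl

end CompactlySupportedMeasure

open MeasureTheory

section FunctionalEquation

variable {S : Type*} [Semigroup S] [TopologicalSpace S] [ContinuousMul S]
  [MeasurableSpace S] [BorelSpace S]
  {ν : Measure S} {w : S → ℂ} {σ : S → S} {f : S → ℂ}

/-- A solution `f` of the equation is `σ`-invariant. -/
lemma comp_eq_self_of_variant_dAlembert
    (hmor : ∀ x y : S, σ (x * y) = σ x * σ y) (hinv : ∀ x : S, σ (σ x) = x)
    (hσc : Continuous σ)
    (hw : Integrable w ν) (hsupp : ∃ K : Set S, IsCompact K ∧ ν Kᶜ = 0)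
    (hσinv : ∀ h : S → ℂ, Continuous h →
      (∫ t, w t * h (σ t) ∂ν) = ∫ t, w t * h t ∂ν)
    (hf : Continuous f)
    (heq : ∀ x y : S, (∫ t, w t * f (x * t * y) ∂ν) + (∫ t, w t * f (σ y * t * x) ∂ν)
        = 2 * f x * f y) (x : S) : f (σ x) = f x := by
  have hdiff : ∀ x y : S, (∫ t, w t * f (x * t * y) ∂ν)
      - (∫ t, w t * f (σ x * t * σ y) ∂ν) = 2 * f x * (f y - f (σ y)) := fun x y => by
    linear_combination heq x y - heq (σ y) x
  have hodd : ∀ x y : S, (∫ t, w t * (f (x * t * y) - f (σ (x * t * y))) ∂ν)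
      = 2 * f x * (f y - f (σ y)) := fun x y => by
    simp_rw [mul_sub]
    rw [integral_sub (integrable_mul_of_continuous hw hsupp (by fun_prop))
      (integrable_mul_of_continuous hw hsupp (by fun_prop)), ← mul_sub, ← hdiff x y]
    simp_rw [hmor]
    rw [hσinv (fun t => f (σ x * t * σ y)) (by fun_prop)]
  have hodd' : ∀ x y : S, 2 * f (σ x) * (f (σ y) - f y) = -(2 * f x * (f y - f (σ y))) := by
    intro x y
    have h := hdiff (σ x) (σ y)
    simp only [hinv] at h
    rw [← h, ← hdiff]
    ring
  have hsq : (f (σ x) - f x) ^ 2 = 0 := by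
    linear_combination hodd' x x / 2
  exact sub_eq_zero.1 (pow_eq_zero_iff two_ne_zero |>.1 hsq)

/-- The double integral of a solution, expressed through single integrals. -/
lemma integral_integral_of_variant_dAlembert
    (hmor : ∀ x y : S, σ (x * y) = σ x * σ y)
    (hσc : Continuous σ)
    (hw : Integrable w ν) (hsupp : ∃ K : Set S, IsCompact K ∧ ν Kᶜ = 0)
    (hσinv : ∀ h : S → ℂ, Continuous h →
      (∫ t, w t * h (σ t) ∂ν) = ∫ t, w t * h t ∂ν)
    (hf : Continuous f)
    (heq : ∀ x y : S, (∫ t, w t * f (x * t * y) ∂ν) + (∫ t, w t * f (σ y * t * x) ∂ν)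
        = 2 * f x * f y) (x y z : S) :
    ∫ s, w s * ∫ t, w t * f (x * s * y * t * z) ∂ν ∂ν =
      (∫ t, w t * f (x * t * y) ∂ν) * f z + f x * (∫ t, w t * f (y * t * z) ∂ν)
        + (∫ t, w t * f (x * t * z) ∂ν) * f y - 2 * f x * f y * f z := by
  have hadd : ∀ {F G : S → S → ℂ}, Continuous (Function.uncurry F) →
      Continuous (Function.uncurry G) → ∀ {p : S → ℂ} {c : ℂ},
      (∀ s, (∫ t, w t * F s t ∂ν) + (∫ t, w t * G s t ∂ν) = c * p s) →
      (∫ s, w s * ∫ t, w t * F s t ∂ν ∂ν) + (∫ s, w s * ∫ t, w t * G s t ∂ν ∂ν)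
        = c * ∫ s, w s * p s ∂ν := by
    intro F G hF hG p c h
    rw [← integral_add
      (integrable_mul_of_continuous hw hsupp (continuous_integral_mul hw hsupp hF))
      (integrable_mul_of_continuous hw hsupp (continuous_integral_mul hw hsupp hG)),
      ← integral_const_mul]
    congr 1
    ext s
    rw [← mul_add, h]
    ring
  have hAB := hadd (F := fun s t => f (x * s * y * t * z))
    (G := fun s t => f (σ z * t * x * s * y)) (p := fun s => f (x * s * y)) (c := 2 * f z)
    (by fun_prop) (by fun_prop) (fun s => by
      have h := heq (x * s * y) z
      simp only [← mul_assoc] at h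
      rw [h]; ring)
  have hAC := hadd (F := fun t s => f (x * s * y * t * z))
    (G := fun t s => f (σ y * σ t * σ z * s * x)) (p := fun t => f (y * t * z)) (c := 2 * f x)
    (by fun_prop) (by fun_prop) (fun t => by
      have h := heq x (y * t * z)
      simp only [← mul_assoc, hmor] at h
      rw [h])
  have hBC := hadd (F := fun t s => f (σ z * t * x * s * y))
    (G := fun t s => f (σ y * s * σ z * t * x)) (p := fun t => f (σ z * t * x)) (c := 2 * f y)
    (by fun_prop) (by fun_prop) (fun t => by
      have h := heq (σ z * t * x) y
      simp only [← mul_assoc] at h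
      rw [h]; ring)
  have hxz := heq x z
  have hA := integral_mul_integral_mul_swap hw hsupp
    (F := fun s t => f (x * s * y * t * z)) (by fun_prop)
  have hB := integral_mul_integral_mul_swap hw hsupp
    (F := fun s t => f (σ z * t * x * s * y)) (by fun_prop)
  have hC := integral_mul_integral_mul_swap hw hsupp
    (F := fun s t => f (σ y * s * σ z * t * x)) (by fun_prop)
  have hCσ := hσinv (fun t => ∫ s, w s * f (σ y * t * σ z * s * x) ∂ν)
    (continuous_integral_mul hw hsupp (F := fun t s => f (σ y * t * σ z * s * x)) (by fun_prop))
  linear_combination (hAB + hAC - hBC) / 2 + hA / 2 - hB / 2 - hC / 2 - hCσ / 2 - f y * hxz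

/-- If `s` satisfies the sine addition law with companion `f`, then the defect of `f` from being
spherical is proportional to `s ⊗ s`. -/
lemma exists_integral_eq_of_sine_addition
    (hw : Integrable w ν) (hsupp : ∃ K : Set S, IsCompact K ∧ ν Kᶜ = 0)
    (hf : Continuous f) {s : S → ℂ} (hs : Continuous s)
    (hsine : ∀ x y, (∫ t, w t * s (x * t * y) ∂ν) = s x * f y + f x * s y)
    {z : S} (hz : s z ≠ 0) :
    ∃ c : ℂ, ∀ x y, (∫ t, w t * f (x * t * y) ∂ν) = f x * f y + c * s x * s y := by
  have hcomm : ∀ x y z, s z * ((∫ t, w t * f (x * t * y) ∂ν) - f x * f y)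
      = s x * ((∫ t, w t * f (y * t * z) ∂ν) - f y * f z) := by
    intro x y z
    have hl : ∫ u, w u * ∫ t, w t * s (x * u * y * t * z) ∂ν ∂ν
        = (s x * f y + f x * s y) * f z + (∫ t, w t * f (x * t * y) ∂ν) * s z := by
      simp_rw [hsine, mul_add, ← mul_assoc]
      rw [integral_add
        ((integrable_mul_of_continuous hw hsupp (by fun_prop)).mul_const _)
        ((integrable_mul_of_continuous hw hsupp (by fun_prop)).mul_const _),
        integral_mul_const, integral_mul_const, hsine]
    have hr : ∫ t, w t * ∫ u, w u * s (x * u * y * t * z) ∂ν ∂ν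
        = s x * (∫ t, w t * f (y * t * z) ∂ν) + f x * (s y * f z + f y * s z) := by
      have h : ∀ t, w t * ∫ u, w u * s (x * u * y * t * z) ∂ν
          = s x * (w t * f (y * t * z)) + f x * (w t * s (y * t * z)) := fun t => by
        have h := hsine x (y * t * z)
        simp only [← mul_assoc] at h
        rw [h]
        simp only [← mul_assoc]
        ring
      simp_rw [h]
      rw [integral_add
        ((integrable_mul_of_continuous hw hsupp (by fun_prop)).const_mul _)
        ((integrable_mul_of_continuous hw hsupp (by fun_prop)).const_mul _),
        integral_const_mul, integral_const_mul, hsine]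
    have hswap := integral_mul_integral_mul_swap hw hsupp
      (F := fun u t => s (x * u * y * t * z)) (by fun_prop)
    linear_combination hswap - hl + hr
  refine ⟨((∫ t, w t * f (z * t * z) ∂ν) - f z * f z) / s z ^ 2, fun x y => ?_⟩
  have h₁ := hcomm x y z
  have h₂ := hcomm y z z
  field_simp
  linear_combination s z * h₁ + s x * h₂

end FunctionalEquation

theorem stmt14 {S : Type*} [Semigroup S] [TopologicalSpace S] [ContinuousMul S]
    [LocallyCompactSpace S] [MeasurableSpace S] [BorelSpace S]
    (σ : S → S) (hσc : Continuous σ)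
    (hmor : ∀ x y : S, σ (x * y) = σ x * σ y)
    (hinv : ∀ x : S, σ (σ x) = x)
    (ν : Measure S) [IsFiniteMeasure ν] (w : S → ℂ) (hw : Integrable w ν)
    (hsupp : ∃ K : Set S, IsCompact K ∧ ν Kᶜ = 0)
    (hσinv : ∀ h : S → ℂ, Continuous h →
      (∫ t, w t * h (σ t) ∂ν) = ∫ t, w t * h t ∂ν)
    (f : S → ℂ) (hf : Continuous f) :
    (∀ x y : S, (∫ t, w t * f (x * t * y) ∂ν) + (∫ t, w t * f (σ y * t * x) ∂ν)
        = 2 * f x * f y) ↔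
    (∃ ψ : S → ℂ, Continuous ψ ∧
      (∀ x y : S, (∫ s, w s * ψ (x * s * y) ∂ν) = ψ x * ψ y) ∧
      ∀ x : S, f x = (ψ x + ψ (σ x)) / 2) := by
  constructor
  · intro heq
    have hfσ := comp_eq_self_of_variant_dAlembert hmor hinv hσc hw hsupp hσinv hf heq
    have htriple := integral_integral_of_variant_dAlembert hmor hσc hw hsupp hσinv hf heq
    by_cases hmul : ∀ x y : S, (∫ t, w t * f (x * t * y) ∂ν) = f x * f y
    · exact ⟨f, hf, hmul, fun x => by rw [hfσ]; ring⟩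
    push Not at hmul
    obtain ⟨a, z, haz⟩ := hmul
    set s : S → ℂ := fun x => (∫ t, w t * f (a * t * x) ∂ν) - f a * f x with hsdef
    have hIc : Continuous fun x => ∫ t, w t * f (a * t * x) ∂ν :=
      continuous_integral_mul hw hsupp (F := fun x t => f (a * t * x)) (by fun_prop)
    have hsc : Continuous s := by fun_prop
    have hz : s z ≠ 0 := sub_ne_zero.2 haz
    have hsine : ∀ x y, (∫ t, w t * s (x * t * y) ∂ν) = s x * f y + f x * s y := by
      intro x y
      have hswap := integral_mul_integral_mul_swap hw hsupp
        (F := fun u t => f (a * u * x * t * y)) (by fun_prop)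
      have hc : Continuous fun t => ∫ u, w u * f (a * u * (x * t * y)) ∂ν :=
        hIc.comp (by fun_prop : Continuous fun t => x * t * y)
      simp only [hsdef, mul_sub, mul_left_comm _ (f a)]
      rw [integral_sub (integrable_mul_of_continuous hw hsupp hc)
        ((integrable_mul_of_continuous hw hsupp (by fun_prop)).const_mul _),
        integral_const_mul]
      simp only [← mul_assoc] at hswap ⊢
      rw [← hswap, htriple]
      ring
    obtain ⟨c, hc⟩ := exists_integral_eq_of_sine_addition hw hsupp hf hsc hsine hz
    obtain ⟨β, rfl⟩ := IsAlgClosed.exists_pow_nat_eq c two_pos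
    have hc0 : β ^ 2 ≠ 0 := by
      intro h
      exact haz (by simpa [h] using hc a z)
    have hsodd : ∀ x, s (σ x) = -s x := by
      intro x
      have h := heq z x
      rw [hc, hc, hfσ] at h
      refine mul_left_cancel₀ (mul_ne_zero hc0 hz) ?_
      linear_combination h
    refine ⟨fun x => f x + β * s x, by fun_prop, fun x y => ?_, fun x => ?_⟩
    · simp only [mul_add, mul_left_comm _ β]
      rw [integral_add (integrable_mul_of_continuous hw hsupp (by fun_prop))
        ((integrable_mul_of_continuous hw hsupp (by fun_prop)).const_mul _),
        integral_const_mul, hsine, hc]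
      ring
    · simp only [hsodd, hfσ]
      ring
  · rintro ⟨ψ, hψ, hmul, hfψ⟩ x y
    have hψσ : ∀ x y, (∫ t, w t * ψ (σ (x * t * y)) ∂ν) = ψ (σ x) * ψ (σ y) := by
      intro x y
      simp_rw [hmor]
      rw [hσinv (fun t => ψ (σ x * t * σ y)) (by fun_prop), hmul]
    have hI : ∀ x y, (∫ t, w t * f (x * t * y) ∂ν)
        = (ψ x * ψ y + ψ (σ x) * ψ (σ y)) / 2 := by
      intro x y
      simp_rw [hfψ, mul_div_assoc', mul_add]
      rw [integral_div, integral_add (integrable_mul_of_continuous hw hsupp (by fun_prop))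
        (integrable_mul_of_continuous hw hsupp (by fun_prop)), hmul, hψσ]
    rw [hI, hI, hfψ, hfψ, hinv]
    ring
end

section
/- Let S be a locally compact topological semigroup, σ : S → S a continuous involutive automorphism, and υ a σ-invariant complex Borel measure with compact support contained in the center of S. A continuous function f : S → ℂ satisfies ∫_S f(xyt) dυ(t) + ∫_S f(σ(y)xt) dυ(t) = 2 f(x) f(y) for all x, y ∈ S if and only if f = ((χ + χ∘σ)/2) · ∫_S χ(t) dυ(t) for some continuous multiplicative function χ : S → ℂ. -/
open MeasureTheory

/-- The product of an integrable density and a function continuous on a compact set carrying the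
measure is integrable. -/
theorem integrable_mul_of_continuous_of_compact_support {S : Type*} [TopologicalSpace S]
    [MeasurableSpace S] [BorelSpace S] {ν : Measure S} {w : S → ℂ} (hw : Integrable w ν)
    {K : Set S} (hK : IsCompact K) (hKν : ν Kᶜ = 0) {h : S → ℂ} (hh : Continuous h) :
    Integrable (fun t => w t * h t) ν := by
  obtain ⟨C, hC⟩ := hK.exists_bound_of_continuousOn hh.continuousOn
  have hae : ∀ᵐ t ∂ν, t ∈ K := hKν
  exact hw.mul_bdd (c := C) hh.measurable.aestronglyMeasurable (hae.mono fun t ht => hC t ht)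

/-- If a linear combination of two multiplicative functions vanishes, then either the functions
agree or each term vanishes. -/
theorem eq_or_forall_eq_zero_of_mul_add_mul_eq_zero {S : Type*} [Semigroup S] {χ₁ χ₂ : S → ℂ}
    (h₁ : ∀ x y, χ₁ (x * y) = χ₁ x * χ₁ y) (h₂ : ∀ x y, χ₂ (x * y) = χ₂ x * χ₂ y)
    {ι : Type*} {A B : ι → ℂ} (h : ∀ x i, χ₁ x * A i + χ₂ x * B i = 0) :
    χ₁ = χ₂ ∨ (∀ x i, χ₁ x * A i = 0) ∧ ∀ x i, χ₂ x * B i = 0 := by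
  by_cases heq : χ₁ = χ₂
  · exact Or.inl heq
  obtain ⟨z, hz⟩ := Function.ne_iff.mp heq
  have hB : ∀ x i, χ₂ x * B i = 0 := fun x i => by
    have e := h (x * z) i
    rw [h₁, h₂] at e
    refine (mul_eq_zero.mp ?_).resolve_left (sub_ne_zero.mpr hz)
    linear_combination χ₁ z * h x i - e
  refine Or.inr ⟨fun x i => ?_, hB⟩
  linear_combination h x i - hB x i

/-- The cosine component of a nonzero solution of the sine addition law on a semigroup is the
mean of two multiplicative functions. -/
theorem exists_multiplicative_of_sine_addition {S : Type*} [Semigroup S] {g h : S → ℂ}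
    (hsin : ∀ x y, h (x * y) = h x * g y + h y * g x) {z : S} (hz : h z ≠ 0) :
    ∃ α : ℂ, (∀ x y, g (x * y) + α * h (x * y) = (g x + α * h x) * (g y + α * h y)) ∧
      ∀ x y, g (x * y) - α * h (x * y) = (g x - α * h x) * (g y - α * h y) := by
  have hswap : ∀ x y u, h u * (g (x * y) - g x * g y) = h x * (g (y * u) - g y * g u) := by
    intro x y u
    have e := congrArg h (mul_assoc x y u)
    rw [hsin, hsin x y, hsin x, hsin y u] at e
    linear_combination e
  obtain ⟨α, hα⟩ : ∃ α : ℂ, α ^ 2 = (g (z * z) - g z * g z) / (h z * h z) :=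
    IsAlgClosed.exists_pow_nat_eq _ two_pos
  have hα' : α ^ 2 * (h z * h z) = g (z * z) - g z * g z := by
    rw [hα]; field_simp
  have hcos : ∀ x y, g (x * y) = g x * g y + α ^ 2 * (h x * h y) := by
    intro x y
    have hzz : h z * h z ≠ 0 := mul_ne_zero hz hz
    apply mul_left_cancel₀ hzz
    linear_combination h z * hswap x y z + h x * hswap y z z - h x * h y * hα'
  refine ⟨α, fun x y => ?_, fun x y => ?_⟩ <;> rw [hcos, hsin] <;> ring

/-- Continuous solutions of the variant `g (xy) + g (σ(y)x) = 2 g(x) g(y)` of d'Alembert's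
functional equation on a topological semigroup. -/
theorem exists_multiplicative_of_dAlembert_variant {S : Type*} [Semigroup S] [TopologicalSpace S]
    [ContinuousMul S] {σ : S → S} (hmor : ∀ x y : S, σ (x * y) = σ x * σ y)
    (hinv : ∀ x : S, σ (σ x) = x) {g : S → ℂ} (hg : Continuous g)
    (heq : ∀ x y, g (x * y) + g (σ y * x) = 2 * g x * g y) :
    ∃ χ : S → ℂ, Continuous χ ∧ (∀ x y, χ (x * y) = χ x * χ y) ∧
      ∀ x, g x = (χ x + χ (σ x)) / 2 := by
  obtain ⟨χ₁, χ₂, hc₁, hc₂, h₁, h₂, hsum⟩ : ∃ χ₁ χ₂ : S → ℂ, Continuous χ₁ ∧ Continuous χ₂ ∧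
      (∀ x y, χ₁ (x * y) = χ₁ x * χ₁ y) ∧ (∀ x y, χ₂ (x * y) = χ₂ x * χ₂ y) ∧
      ∀ x, g x = (χ₁ x + χ₂ x) / 2 := by
    by_cases hm : ∀ a x, g (a * x) - g a * g x = 0
    · exact ⟨g, g, hg, hg, fun x y => sub_eq_zero.mp (hm x y),
        fun x y => sub_eq_zero.mp (hm x y), fun x => by ring⟩
    push Not at hm
    obtain ⟨a, z, hz⟩ := hm
    have hsin : ∀ x y, g (a * (x * y)) - g a * g (x * y)
        = (g (a * x) - g a * g x) * g y + (g (a * y) - g a * g y) * g x := by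
      intro x y
      have e₁ := heq (a * x) y
      have e₂ := heq (σ y * a) x
      have e₃ := heq a (x * y)
      have e₄ := heq a y
      simp only [hmor, mul_assoc] at e₁ e₂ e₃ e₄ ⊢
      linear_combination (e₁ - e₂ + e₃) / 2 - g x * e₄
    obtain ⟨α, hp, hn⟩ := exists_multiplicative_of_sine_addition
      (h := fun x => g (a * x) - g a * g x) hsin hz
    exact ⟨fun x => g x + α * (g (a * x) - g a * g x), fun x => g x - α * (g (a * x) - g a * g x),
      by fun_prop, by fun_prop, hp, hn, fun x => by ring⟩
  have key : ∀ x y, χ₁ x * (χ₁ (σ y) - χ₂ y) + χ₂ x * (χ₂ (σ y) - χ₁ y) = 0 := by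
    intro x y
    have e := heq x y
    simp only [hsum, h₁, h₂] at e
    linear_combination 2 * e
  refine ⟨χ₁, hc₁, h₁, fun x => ?_⟩
  rw [hsum]
  suffices χ₂ x = χ₁ (σ x) by rw [this]
  rcases eq_or_forall_eq_zero_of_mul_add_mul_eq_zero h₁ h₂ key with h | ⟨hA, hB⟩
  · subst h
    by_cases h0 : ∀ u, χ₁ u = 0
    · rw [h0, h0]
    push Not at h0
    obtain ⟨u, hu⟩ := h0
    apply mul_left_cancel₀ hu
    linear_combination -key u x / 2
  · by_cases h0 : ∀ u, χ₁ u = 0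
    · have e := hB x (σ x)
      rw [hinv, h0, sub_zero] at e
      rw [h0, mul_self_eq_zero.mp e]
    push Not at h0
    obtain ⟨u, hu⟩ := h0
    exact (sub_eq_zero.mp ((mul_eq_zero.mp (hA u x)).resolve_left hu)).symm

/-- An antisymmetric two-variable function that is cyclically invariant in its arguments and
changes sign under `σ` on a left factor vanishes on threefold products. -/
theorem eq_zero_of_cyclic_of_map_left_neg {S : Type*} [Semigroup S] {σ : S → S}
    (hmor : ∀ x y : S, σ (x * y) = σ x * σ y) {D : S → S → ℂ}
    (hcyc : ∀ a x y, D y (a * x) = D a (x * y))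
    (hneg : ∀ x y a, D x (σ y * a) = -D x (y * a)) (x y z a : S) :
    D x (y * (z * a)) = 0 := by
  have e₁ := hneg x (y * z) a
  have e₂ := hneg x y (σ z * a)
  have e₃ := hcyc y (σ z * a) x
  have e₄ := hneg y z (a * x)
  have e₅ := hcyc y (z * a) x
  simp only [hmor, mul_assoc] at e₁ e₂ e₃ e₄ e₅
  have : D x (y * (z * a)) = -D x (y * (z * a)) := by
    linear_combination e₅ + e₄ + e₃ - e₂ + e₁
  exact self_eq_neg.mp this

/-- A solution of the integral equation is, up to a constant, an eigenfunction of translation by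
the measure. -/
theorem integral_translate_eq_const_mul {S : Type*} [Semigroup S] [TopologicalSpace S]
    [ContinuousMul S] [MeasurableSpace S] [BorelSpace S] {σ : S → S} (hσc : Continuous σ)
    (hmor : ∀ x y : S, σ (x * y) = σ x * σ y) {ν : Measure S} {w : S → ℂ} (hw : Integrable w ν)
    {K : Set S} (hK : IsCompact K) (hKν : ν Kᶜ = 0) (hcent : ∀ k ∈ K, ∀ s : S, k * s = s * k)
    (hσinv : ∀ h : S → ℂ, Continuous h →
      (∫ t, w t * h (σ t) ∂ν) = ∫ t, w t * h t ∂ν)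
    {f : S → ℂ} (hf : Continuous f)
    (heq : ∀ x y : S, (∫ t, w t * f (x * y * t) ∂ν) + (∫ t, w t * f (σ y * x * t) ∂ν)
        = 2 * f x * f y) :
    (∀ x, f x = 0) ∨ ∃ c : ℂ, c ≠ 0 ∧ ∀ x, (∫ t, w t * f (x * t) ∂ν) = c * f x := by
  have hae : ∀ᵐ t ∂ν, t ∈ K := hKν
  have hint : ∀ {h : S → ℂ}, Continuous h → Integrable (fun t => w t * h t) ν :=
    fun hh => integrable_mul_of_continuous_of_compact_support hw hK hKν hh
  set F : S → ℂ := fun x => ∫ t, w t * f (x * t) ∂ν with hF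
  have hE : ∀ x y, F (x * y) + F (σ y * x) = 2 * f x * f y := heq
  have hT : ∀ a x y,
      F (a * (x * y)) = f (a * x) * f y - f (σ y * a) * f x + f a * f (x * y) := by
    intro a x y
    have e₁ := hE (a * x) y
    have e₂ := hE (σ y * a) x
    have e₃ := hE a (x * y)
    simp only [hmor, mul_assoc] at e₁ e₂ e₃ ⊢
    linear_combination (e₁ - e₂ + e₃) / 2
  have hcomb : ∀ (p q r : S → ℂ) (A B C : ℂ), Continuous p → Continuous q → Continuous r →
      (∫ t, w t * (p t * A - q t * B + r t * C) ∂ν)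
        = (∫ t, w t * p t ∂ν) * A - (∫ t, w t * q t ∂ν) * B + (∫ t, w t * r t ∂ν) * C := by
    intro p q r A B C hp hq hr
    rw [← integral_mul_const, ← integral_mul_const, ← integral_mul_const,
      ← integral_sub ((hint hp).mul_const A) ((hint hq).mul_const B),
      ← integral_add (f := fun t => w t * p t * A - w t * q t * B)
        (((hint hp).mul_const A).sub ((hint hq).mul_const B)) ((hint hr).mul_const C)]
    congr 1
    ext t
    ring
  have hx : ∀ a x y, (∫ t, w t * F (a * (x * y) * t) ∂ν)
      = F (a * x) * f y - F x * f (σ y * a) + F (x * y) * f a := by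
    intro a x y
    rw [← hcomb (fun t => f (a * x * t)) (fun t => f (x * t)) (fun t => f (x * y * t))
      _ _ _ (by fun_prop) (by fun_prop) (by fun_prop)]
    refine integral_congr_ae (hae.mono fun t ht => ?_)
    have e := hT a (x * t) y
    simp only [mul_assoc, hcent t ht y] at e ⊢
    rw [e]; ring
  have hσF : ∀ y a, (∫ t, w t * f (σ y * (σ t * a)) ∂ν) = F (σ y * a) := by
    intro y a
    rw [hσinv (fun t => f (σ y * (t * a))) (by fun_prop)]
    refine integral_congr_ae (hae.mono fun t ht => ?_)
    simp only [hcent t ht a, mul_assoc]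
  have hy : ∀ a x y, (∫ t, w t * F (a * (x * y) * t) ∂ν)
      = F y * f (a * x) - F (σ y * a) * f x + F (x * y) * f a := by
    intro a x y
    rw [← hσF, ← hcomb (fun t => f (y * t)) (fun t => f (σ y * (σ t * a)))
      (fun t => f (x * y * t)) _ _ _ (by fun_prop) (by fun_prop) (by fun_prop)]
    congr 1
    ext t
    have e := hT a x (y * t)
    simp only [mul_assoc, hmor] at e ⊢
    rw [e]; ring
  have ha : ∀ a x y, (∫ t, w t * F (a * (x * y) * t) ∂ν)
      = F (a * x) * f y - F (σ y * a) * f x + F a * f (x * y) := by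
    intro a x y
    rw [← hcomb (fun t => f (a * x * t)) (fun t => f (σ y * a * t)) (fun t => f (a * t))
      _ _ _ (by fun_prop) (by fun_prop) (by fun_prop)]
    refine integral_congr_ae (hae.mono fun t ht => ?_)
    have e := hT (a * t) x y
    rw [mul_assoc a t, mul_assoc a t, hcent t ht x, hcent t ht (x * y)] at e
    simp only [mul_assoc] at e ⊢
    rw [e]
  have hcyc : ∀ a x y, F y * f (a * x) - f y * F (a * x) = F a * f (x * y) - f a * F (x * y) :=
    fun a x y => by linear_combination ha a x y - hy a x y
  have hzero := eq_zero_of_cyclic_of_map_left_neg (D := fun u v => F u * f v - f u * F v) hmor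
    hcyc fun x y a => by
      linear_combination hx a x y - ha a x y - hcyc x y a
  by_cases hp : ∀ x y z, f (x * (y * z)) = 0
  · refine Or.inl fun x => ?_
    have hF0 : ∀ u v, F (u * v) = 0 := fun u v => by
      simp only [hF, mul_assoc, hp, mul_zero, integral_zero]
    have e := hE x x
    rw [hF0, hF0] at e
    exact mul_self_eq_zero.mp (by linear_combination -e / 2)
  push Not at hp
  obtain ⟨u, v, z, hp⟩ := hp
  have hFc : ∀ x, F x = F (u * (v * z)) / f (u * (v * z)) * f x := fun x => by
    field_simp
    linear_combination hzero x u v z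
  refine or_iff_not_imp_right.mpr fun hc x => ?_
  have hc0 : F (u * (v * z)) / f (u * (v * z)) = 0 := by
    by_contra h
    exact hc ⟨_, h, hFc⟩
  have e := hE x x
  rw [hFc, hFc (σ x * x), hc0] at e
  exact mul_self_eq_zero.mp (by linear_combination -e / 2)

theorem stmt15 {S : Type*} [Semigroup S] [TopologicalSpace S] [ContinuousMul S]
    [LocallyCompactSpace S] [MeasurableSpace S] [BorelSpace S]
    (σ : S → S) (hσc : Continuous σ)
    (hmor : ∀ x y : S, σ (x * y) = σ x * σ y)
    (hinv : ∀ x : S, σ (σ x) = x)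
    (ν : Measure S) [IsFiniteMeasure ν] (w : S → ℂ) (hw : Integrable w ν)
    (hsupp : ∃ K : Set S, IsCompact K ∧ ν Kᶜ = 0 ∧ ∀ k ∈ K, ∀ s : S, k * s = s * k)
    (hσinv : ∀ h : S → ℂ, Continuous h →
      (∫ t, w t * h (σ t) ∂ν) = ∫ t, w t * h t ∂ν)
    (f : S → ℂ) (hf : Continuous f) :
    (∀ x y : S, (∫ t, w t * f (x * y * t) ∂ν) + (∫ t, w t * f (σ y * x * t) ∂ν)
        = 2 * f x * f y) ↔
    (∃ χ : S → ℂ, Continuous χ ∧ (∀ x y : S, χ (x * y) = χ x * χ y) ∧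
      ∀ x : S, f x = (χ x + χ (σ x)) / 2 * ∫ t, w t * χ t ∂ν) := by
  obtain ⟨K, hK, hKν, hcent⟩ := hsupp
  have hmean : ∀ χ : S → ℂ, Continuous χ → (∀ x y : S, χ (x * y) = χ x * χ y) →
      ∀ c x, (∫ t, w t * ((χ (x * t) + χ (σ (x * t))) / 2 * c) ∂ν)
        = (χ x + χ (σ x)) / 2 * c * ∫ t, w t * χ t ∂ν := by
    intro χ hχ hχm c x
    have h₁ := integrable_mul_of_continuous_of_compact_support hw hK hKν hχ
    have h₂ : Integrable (fun t => w t * χ (σ t)) ν :=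
      integrable_mul_of_continuous_of_compact_support hw hK hKν (hχ.comp hσc)
    calc (∫ t, w t * ((χ (x * t) + χ (σ (x * t))) / 2 * c) ∂ν)
        = ∫ t, χ x / 2 * c * (w t * χ t) + χ (σ x) / 2 * c * (w t * χ (σ t)) ∂ν := by
          congr 1
          ext t
          rw [hmor, hχm, hχm]
          ring
      _ = (χ x + χ (σ x)) / 2 * c * ∫ t, w t * χ t ∂ν := by
          rw [integral_add (h₁.const_mul _) (h₂.const_mul _), integral_const_mul,
            integral_const_mul, hσinv χ hχ]
          ring
  constructor
  · intro heq
    rcases integral_translate_eq_const_mul hσc hmor hw hK hKν hcent hσinv hf heq with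
      h0 | ⟨c, hc, hfc⟩
    · exact ⟨fun _ => 0, continuous_const, by simp, by simpa using h0⟩
    obtain ⟨χ, hχ, hχm, hχf⟩ := exists_multiplicative_of_dAlembert_variant hmor hinv
      (g := fun x => f x / c) (hf.div_const c) fun x y => by
        have e := heq x y
        rw [hfc, hfc] at e
        field_simp
        linear_combination e
    have hfχ : ∀ x, f x = (χ x + χ (σ x)) / 2 * c := fun x => (div_eq_iff hc).mp (hχf x)
    refine ⟨χ, hχ, hχm, fun x => ?_⟩
    have e := hfc x
    simp only [hfχ] at e
    rw [hmean χ hχ hχm] at e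
    rw [hfχ]
    apply mul_left_cancel₀ hc
    linear_combination -e
  · rintro ⟨χ, hχ, hχm, hfχ⟩ x y
    simp only [hfχ]
    rw [hmean χ hχ hχm, hmean χ hχ hχm]
    simp only [hmor, hinv, hχm]
    ring
end
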